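/- arXiv:1310.2930 — 2 statements merged into one kernel-verified Lean document; each statement's English description precedes it below -/
import Mathlib

section
/- Let ν be a nonempty partition of type 1 such that ν contains the rectangle (ν₁^{ν₁−1}) (the partition with ν₁ − 1 parts equal to ν₁). Then (ν, 1), the partition obtained from ν by appending a part equal to 1, does not cover ν. -/
/-- A partition, 0-indexed: `f i` is the `(i+1)`-st part. A partition is a weakly
decreasing, eventually zero function `ℕ → ℕ`. -/
def IsPartition (f : ℕ → ℕ) : Prop := Antitone f ∧ ∃ N, f N = 0

/-- The number of (nonzero) parts of a partition. -/
noncomputable def plen (f : ℕ → ℕ) : ℕ := sInf {n | f n = 0}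

/-- The size (weight) of a partition: the sum of its parts. -/
noncomputable def psize (f : ℕ → ℕ) : ℕ := ∑ i ∈ Finset.range (plen f), f i

/-- Containment of partitions: `subP f g` means `f ⊆ g`, i.e. `f i ≤ g i` for all `i`. -/
def subP (f g : ℕ → ℕ) : Prop := ∀ i, f i ≤ g i

/-- The conjugate partition: `conjP f j = #{i : f i > j}` (0-indexed). -/
noncomputable def conjP (f : ℕ → ℕ) : ℕ → ℕ := fun j => Nat.card {i : ℕ // j < f i}

/-- The square partition `(s^s)`. -/
def squareP (s : ℕ) : ℕ → ℕ := fun j => if j < s then s else 0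

/-- The partition `(s^s, 1)`: `s` parts equal to `s` followed by a part equal to `1`. -/
def squareP1 (s : ℕ) : ℕ → ℕ := fun j => if j < s then s else if j = s then 1 else 0

/-- The complement of `f` in the square `(m^m)`: the `(i+1)`-st part (0-indexed `i < m`)
is `m - f (m - 1 - i)`. -/
def complP (m : ℕ) (f : ℕ → ℕ) : ℕ → ℕ := fun i => if i < m then m - f (m - 1 - i) else 0

/-- `ν + (1)`: add one box at the end of the first row. -/
def addRow1 (f : ℕ → ℕ) : ℕ → ℕ := fun j => if j = 0 then f 0 + 1 else f j

/-- `(ν, 1)`: append a part equal to `1` after the last nonzero part. -/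
noncomputable def addPart1 (f : ℕ → ℕ) : ℕ → ℕ :=
  fun j => if j < plen f then f j else if j = plen f then 1 else 0

/-- Delete the first `k` columns of a partition. -/
def colDel (k : ℕ) (f : ℕ → ℕ) : ℕ → ℕ := fun j => f j - k

/-- Delete the first `s` rows of a partition. -/
def rowDel (s : ℕ) (f : ℕ → ℕ) : ℕ → ℕ := fun j => f (j + s)

/-- The sequence whose first `m` entries are given by `f` and whose subsequent entries
are given by `g`; used to form `(η^{c,m} + γ, σ)`. -/
def appendAfter (m : ℕ) (f g : ℕ → ℕ) : ℕ → ℕ := fun i => if i < m then f i else g (i - m)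

/-- The cell in row `r`, column `c` (both 0-indexed) belongs to the skew diagram
`lam/alpha`. -/
def inShape (lam alpha : ℕ → ℕ) (r c : ℕ) : Prop := alpha r ≤ c ∧ c < lam r

/-- A Littlewood–Richardson tableau of shape `lam/alpha` and content `beta`
(for each `k`, there are `beta k` entries equal to `k + 1`): a semistandard filling of
the skew diagram whose reverse reading word is a lattice permutation.  The lattice
condition is expressed by comparing, in every prefix of the reverse reading word ending
at a cell `(r, c)` (all cells in rows above `r`, together with the cells in row `r`
weakly to the right of column `c`), the number of entries `k + 2` with the number of
entries `k + 1`. -/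
structure LRTableau (lam alpha beta : ℕ → ℕ) where
  entry : ℕ → ℕ → ℕ
  zero_outside : ∀ r c, ¬ inShape lam alpha r c → entry r c = 0
  one_le : ∀ r c, inShape lam alpha r c → 1 ≤ entry r c
  row_weak : ∀ r c₁ c₂, c₁ ≤ c₂ → inShape lam alpha r c₁ → inShape lam alpha r c₂ →
    entry r c₁ ≤ entry r c₂
  col_strict : ∀ r₁ r₂ c, r₁ < r₂ → inShape lam alpha r₁ c → inShape lam alpha r₂ c →
    entry r₁ c < entry r₂ c
  content : ∀ k : ℕ,
    Nat.card {p : ℕ × ℕ // inShape lam alpha p.1 p.2 ∧ entry p.1 p.2 = k + 1} = beta k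
  lattice : ∀ r c k : ℕ, inShape lam alpha r c →
    Nat.card {p : ℕ × ℕ // inShape lam alpha p.1 p.2 ∧
        (p.1 < r ∨ (p.1 = r ∧ c ≤ p.2)) ∧ entry p.1 p.2 = k + 2} ≤
    Nat.card {p : ℕ × ℕ // inShape lam alpha p.1 p.2 ∧
        (p.1 < r ∨ (p.1 = r ∧ c ≤ p.2)) ∧ entry p.1 p.2 = k + 1}

open Classical in
/-- The Littlewood–Richardson coefficient `c^lam_{alpha, beta}`: the number of LR
tableaux of shape `lam/alpha` and content `beta`, or `0` if `alpha ⊄ lam`. -/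
noncomputable def LRcoeff (lam alpha beta : ℕ → ℕ) : ℕ :=
  if subP alpha lam then Nat.card (LRTableau lam alpha beta) else 0

/-- `mu` covers `nu`: for every integer `m ≥ μ₁ + ℓ(μ)` and every partition `lam`,
`c^lam_{ν^{c,m}, ν'} ≤ c^lam_{μ^{c,m}, μ'}`, i.e. `s_{μ'} s_{μ^c} - s_{ν'} s_{ν^c}`
is Schur-positive (complements taken in `(m^m)`). -/
def Covers (mu nu : ℕ → ℕ) : Prop :=
  ∀ m : ℕ, mu 0 + plen mu ≤ m → ∀ lam : ℕ → ℕ, IsPartition lam →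
    LRcoeff lam (complP m nu) (conjP nu) ≤ LRcoeff lam (complP m mu) (conjP mu)

/-- The partition `(i^{s+1}, i, i-1, ..., 2, 1)` (as a 0-indexed function). -/
def betaShape (i s : ℕ) : ℕ → ℕ := fun j => if j ≤ s + 1 then i else i + s + 1 - j

/-- A partition is of type 1 if it contains `(i, i, i-1, ..., 2, 1)` where `i` is its
first part. -/
def Type1 (nu : ℕ → ℕ) : Prop := IsPartition nu ∧ subP (betaShape (nu 0) 0) nu

/-- `nu = beta + (s^s) + alpha` (componentwise) is a type-2 decomposition: `s ≥ 1`,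
`alpha` is a nonempty partition with at most `s` parts, and `beta` is a (possibly empty)
partition containing `(i^{s+1}, i, i-1, ..., 2, 1)` where `i = beta 0`. -/
def IsType2Decomp (nu beta : ℕ → ℕ) (s : ℕ) (alpha : ℕ → ℕ) : Prop :=
  IsPartition beta ∧ IsPartition alpha ∧ 1 ≤ s ∧ alpha 0 ≠ 0 ∧ plen alpha ≤ s ∧
    subP (betaShape (beta 0) s) beta ∧ ∀ j, nu j = beta j + squareP s j + alpha j

/-- A partition is of type 2 if it admits a type-2 decomposition. -/
def Type2 (nu : ℕ → ℕ) : Prop := ∃ beta s alpha, IsType2Decomp nu beta s alpha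

/-- A self-conjugate partition. -/
def SelfConjugate (t : ℕ → ℕ) : Prop := ∀ j, conjP t j = t j

/-- A partition `nu` is corner-symmetric if for every outer corner of `nu` in row
`r + 1 ≥ 2` (1-indexed), i.e. every 0-indexed row `r ≥ 1` with `nu r < nu (r-1)`
(the corner cell lying in 0-indexed column `nu r`), there is a nonempty partition
`η ⊆ nu` such that the skew diagram `nu/η` is, up to translation, the Young diagram of
a self-conjugate partition, contains the cell `(r-1, nu r)` (0-indexed), and contains
no cell in any column of 0-indexed column index `< nu r`. -/
def CornerSymmetric (nu : ℕ → ℕ) : Prop :=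
  ∀ r : ℕ, 1 ≤ r → nu r < nu (r - 1) →
    ∃ η : ℕ → ℕ, IsPartition η ∧ subP η nu ∧ η 0 ≠ 0 ∧
      ∃ t : ℕ → ℕ, ∃ r0 c0 : ℕ, IsPartition t ∧ SelfConjugate t ∧
        (∀ a b : ℕ, (η a ≤ b ∧ b < nu a) ↔ (r0 ≤ a ∧ c0 ≤ b ∧ b - c0 < t (a - r0))) ∧
        η (r - 1) ≤ nu r ∧
        (∀ a b : ℕ, η a ≤ b → b < nu a → nu r ≤ b)

/-- The cells of the first `R` rows lying between the profiles `u` and `v`, counted by rows. -/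
theorem card_cells_between (R : ℕ) (u v : ℕ → ℕ) :
    Nat.card {p : ℕ × ℕ // p.1 < R ∧ u p.1 ≤ p.2 ∧ p.2 < v p.1} =
      ∑ r ∈ Finset.range R, (v r - u r) := by
  rw [Nat.subtype_card (((Finset.range R).sigma fun r => Finset.Ico (u r) (v r)).map
    (Equiv.sigmaEquivProd ℕ ℕ).toEmbedding)]
  · simp
  · rintro ⟨r, c⟩
    simp [Finset.mem_map_equiv, Equiv.sigmaEquivProd]

theorem exists_finset_inShape {lam : ℕ → ℕ} (hlam : IsPartition lam) (alpha : ℕ → ℕ) :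
    ∃ S : Finset (ℕ × ℕ), ∀ p, p ∈ S ↔ inShape lam alpha p.1 p.2 := by
  classical
  obtain ⟨hanti, N, hN⟩ := hlam
  refine ⟨(Finset.range N ×ˢ Finset.range (lam 0)).filter fun p => inShape lam alpha p.1 p.2, ?_⟩
  rintro ⟨r, c⟩
  simp only [Finset.mem_filter, Finset.mem_product, Finset.mem_range, and_iff_right_iff_imp]
  rintro ⟨-, hc⟩
  refine ⟨?_, hc.trans_le (hanti (Nat.zero_le r))⟩
  by_contra! h
  have := hanti h
  omega

theorem complP_antitone (m : ℕ) {f : ℕ → ℕ} (hf : Antitone f) : Antitone (complP m f) := by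
  intro a b hab
  simp only [complP]
  split_ifs <;> try omega
  have := hf (show m - 1 - b ≤ m - 1 - a by omega)
  omega

namespace LRTableau

variable {lam alpha beta : ℕ → ℕ}

theorem content_pos (hlam : IsPartition lam) (T : LRTableau lam alpha beta) {r c k : ℕ}
    (h : inShape lam alpha r c) (hk : T.entry r c = k + 1) : 0 < beta k := by
  classical
  obtain ⟨S, hS⟩ := exists_finset_inShape hlam alpha
  rw [← T.content k, Nat.subtype_card (S.filter fun p => T.entry p.1 p.2 = k + 1)
    (fun p => by simp [hS]), Finset.card_pos]
  exact ⟨(r, c), by simp [hS, h, hk]⟩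

theorem finite (hlam : IsPartition lam) {K : ℕ} (hK : ∀ k, K ≤ k → beta k = 0) :
    Finite (LRTableau lam alpha beta) := by
  obtain ⟨S, hS⟩ := exists_finset_inShape hlam alpha
  have hle (T : LRTableau lam alpha beta) (p : S) : T.entry p.1.1 p.1.2 < K + 1 := by
    have hp := (hS _).1 p.2
    have h1 := T.one_le _ _ hp
    have h2 := T.content_pos hlam (k := T.entry p.1.1 p.1.2 - 1) hp (by omega)
    by_contra! h
    rw [hK _ (by omega)] at h2
    omega
  refine Finite.of_injective
    (fun (T : LRTableau lam alpha beta) (p : S) => (⟨_, hle T p⟩ : Fin (K + 1))) ?_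
  intro T U h
  have : T.entry = U.entry := by
    funext r c
    by_cases hrc : inShape lam alpha r c
    · simpa using congrFun h ⟨(r, c), (hS _).2 hrc⟩
    · rw [T.zero_outside _ _ hrc, U.zero_outside _ _ hrc]
  cases T; cases U; cases this; rfl

/-- In a Littlewood–Richardson tableau, the entries `k + 2` in the first `r + 1` rows are at
most as many as the entries `k + 1` in the first `r` rows. -/
theorem card_succ_le (T : LRTableau lam alpha beta) {S : Finset (ℕ × ℕ)}
    (hS : ∀ p, p ∈ S ↔ inShape lam alpha p.1 p.2) (k r : ℕ) :
    (S.filter fun p => p.1 < r + 1 ∧ T.entry p.1 p.2 = k + 2).card ≤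
      (S.filter fun p => p.1 < r ∧ T.entry p.1 p.2 = k + 1).card := by
  classical
  by_cases hex : ∃ c, inShape lam alpha r c ∧ T.entry r c = k + 2
  · obtain ⟨hc, hmin⟩ := And.intro (Nat.find_spec hex) fun c' => Nat.find_min' hex (m := c')
    set c := Nat.find hex
    have hl := T.lattice r c k hc.1
    rw [Nat.subtype_card (S.filter fun p => (p.1 < r ∨ (p.1 = r ∧ c ≤ p.2)) ∧
        T.entry p.1 p.2 = k + 2) (fun p => by simp [hS]),
      Nat.subtype_card (S.filter fun p => (p.1 < r ∨ (p.1 = r ∧ c ≤ p.2)) ∧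
        T.entry p.1 p.2 = k + 1) (fun p => by simp [hS])] at hl
    refine (Finset.card_le_card ?_).trans (hl.trans (Finset.card_le_card ?_))
    · rintro ⟨a, b⟩ h
      simp only [Finset.mem_filter, hS] at h ⊢
      obtain ⟨hs, ha, he⟩ := h
      refine ⟨hs, ?_, he⟩
      rcases Nat.lt_succ_iff_lt_or_eq.1 ha with h' | rfl
      · exact Or.inl h'
      · exact Or.inr ⟨rfl, hmin b ⟨hs, he⟩⟩
    · rintro ⟨a, b⟩ h
      simp only [Finset.mem_filter, hS] at h ⊢
      obtain ⟨hs, ha | ⟨rfl, hcb⟩, he⟩ := h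
      · exact ⟨hs, ha, he⟩
      · have := T.row_weak _ _ _ hcb hc.1 hs
        omega
  · have hsub : (S.filter fun p => p.1 < r + 1 ∧ T.entry p.1 p.2 = k + 2) ⊆
        S.filter fun p => p.1 < r ∧ T.entry p.1 p.2 = k + 2 := by
      rintro ⟨a, b⟩ h
      simp only [Finset.mem_filter, hS] at h ⊢
      obtain ⟨hs, ha, he⟩ := h
      refine ⟨hs, ?_, he⟩
      rcases Nat.lt_succ_iff_lt_or_eq.1 ha with h' | rfl
      · exact h'
      · exact (hex ⟨b, hs, he⟩).elim
    refine (Finset.card_le_card hsub).trans ?_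
    cases r with
    | zero => simp
    | succ s =>
      refine (T.card_succ_le hS k s).trans (Finset.card_le_card ?_)
      intro p
      simp only [Finset.mem_filter]
      rintro ⟨h1, h2, h3⟩
      exact ⟨h1, by omega, h3⟩

theorem card_entry_le_card_one (T : LRTableau lam alpha beta) {S : Finset (ℕ × ℕ)}
    (hS : ∀ p, p ∈ S ↔ inShape lam alpha p.1 p.2) (k r : ℕ) :
    (S.filter fun p => p.1 < r + k ∧ T.entry p.1 p.2 = k + 1).card ≤
      (S.filter fun p => p.1 < r ∧ T.entry p.1 p.2 = 1).card := by
  induction k with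
  | zero => simp
  | succ k ih => exact (T.card_succ_le hS k (r + k)).trans ih

theorem card_one_le (T : LRTableau lam alpha beta) {S : Finset (ℕ × ℕ)}
    (hS : ∀ p, p ∈ S ↔ inShape lam alpha p.1 p.2) (halpha : Antitone alpha) {M : ℕ}
    (hM : ∀ r, lam r ≤ M) (r : ℕ) :
    (S.filter fun p => p.1 < r + 1 ∧ T.entry p.1 p.2 = 1).card ≤ M - alpha r := by
  rw [← Nat.card_Ico]
  refine Finset.card_le_card_of_injOn Prod.snd ?_ ?_
  · rintro ⟨a, b⟩ h
    simp only [Finset.coe_filter, Set.mem_ofPred_eq, hS, inShape] at h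
    have := halpha (show a ≤ r by omega)
    have := hM a
    simp only [Finset.coe_Ico, Set.mem_Ico]
    omega
  · rintro ⟨a, b⟩ h ⟨a', b'⟩ h' hbb
    simp only [Finset.coe_filter, Set.mem_ofPred_eq, hS] at h h' hbb
    subst hbb
    rcases lt_trichotomy a a' with hlt | rfl | hlt
    · have := T.col_strict _ _ _ hlt h.1 h'.1
      omega
    · rfl
    · have := T.col_strict _ _ _ hlt h'.1 h.1
      omega

/-- If a Littlewood–Richardson tableau has inner shape the complement of `mu` in `(m^m)`, and
outer shape of width at most `m`, then the entries `k + 1` in its first `m` rows are at most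
`mu k` in number: the content of this part is contained in `mu`. -/
theorem card_cells_le {mu : ℕ → ℕ} {m : ℕ} (hlam : IsPartition lam)
    (T : LRTableau lam (complP m mu) beta) (hmu : Antitone mu) (hm : mu 0 ≤ m)
    (hM : ∀ r, lam r ≤ m) (hbeta : ∀ k, m ≤ k → beta k = 0) :
    ∑ r ∈ Finset.range m, (lam r - complP m mu r) ≤
      ∑ k ∈ Finset.range m, min (beta k) (mu k) := by
  classical
  obtain ⟨S, hS⟩ := exists_finset_inShape hlam (complP m mu)
  rw [← card_cells_between, Nat.subtype_card (S.filter fun p => p.1 < m)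
    (fun p => by simp [hS, inShape, and_comm]),
    Finset.card_eq_sum_card_fiberwise (f := fun p => T.entry p.1 p.2 - 1) (t := Finset.range m)]
  · refine Finset.sum_le_sum fun k hk => le_min ?_ ?_
    · rw [← T.content k, Nat.subtype_card (S.filter fun p => T.entry p.1 p.2 = k + 1)
        (fun p => by simp [hS])]
      refine Finset.card_le_card fun p => ?_
      simp only [Finset.mem_filter]
      rintro ⟨⟨hp, -⟩, he⟩
      have := T.one_le _ _ ((hS p).1 hp)
      exact ⟨hp, by omega⟩
    · have hk' := Finset.mem_range.1 hk
      have h1 := (T.card_entry_le_card_one hS k (m - k - 1 + 1)).trans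
        (T.card_one_le hS (complP_antitone m hmu) hM (m - k - 1))
      have h2 : m - complP m mu (m - k - 1) = mu k := by
        have := hmu (Nat.zero_le k)
        rw [complP, if_pos (by omega), show m - 1 - (m - k - 1) = k by omega]
        omega
      rw [h2, show m - k - 1 + 1 + k = m by omega] at h1
      refine (Finset.card_le_card fun p => ?_).trans h1
      simp only [Finset.mem_filter]
      rintro ⟨⟨hp, hpm⟩, he⟩
      have := T.one_le _ _ ((hS p).1 hp)
      exact ⟨hp, hpm, by omega⟩
  · intro p hp
    simp only [Finset.coe_filter, Set.mem_ofPred_eq, hS] at hp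
    have h1 := T.one_le _ _ hp.1
    have h2 := T.content_pos hlam (k := T.entry p.1 p.2 - 1) hp.1 (by omega)
    simp only [Finset.coe_range, Set.mem_Iio]
    by_contra! h
    rw [hbeta _ h] at h2
    omega

end LRTableau

/-- The room `m - alpha (n - 1)` to the right of `alpha` in row `n - 1`, and `0` for `n = 0`. -/
def room (m : ℕ) (alpha : ℕ → ℕ) : ℕ → ℕ
  | 0 => 0
  | n + 1 => m - alpha n

/-- The number of entries `k + 1` in the first `r` rows of the minimal tableau on `alpha` with
content `beta`. -/
def minCount (m : ℕ) (alpha beta : ℕ → ℕ) (k r : ℕ) : ℕ := min (beta k) (room m alpha (r - k))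

/-- The right end of row `r` of `alpha` together with the entries at most `k` of the minimal
tableau. -/
def minEnd (m : ℕ) (alpha beta : ℕ → ℕ) (k r : ℕ) : ℕ :=
  alpha r + ∑ j ∈ Finset.range k, (minCount m alpha beta j (r + 1) - minCount m alpha beta j r)

/-- The outer shape of the minimal tableau. Its first `m` rows are the sorted sum of `alpha` and
the reversal of `beta` when `beta` has at most `m` parts. -/
def minShape (m : ℕ) (alpha beta : ℕ → ℕ) (r : ℕ) : ℕ := minEnd m alpha beta (r + 1) r

section MinTableau

variable {m : ℕ} {alpha beta : ℕ → ℕ}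

theorem room_mono (ha : Antitone alpha) : Monotone (room m alpha) := by
  refine monotone_nat_of_le_succ fun n => ?_
  cases n with
  | zero => exact Nat.zero_le _
  | succ n => exact Nat.sub_le_sub_left (ha n.le_succ) m

theorem minCount_mono (ha : Antitone alpha) (k : ℕ) : Monotone (minCount m alpha beta k) :=
  fun _ _ h => min_le_min_left _ (room_mono ha (Nat.sub_le_sub_right h k))

theorem minCount_eq_zero {k r : ℕ} (h : r ≤ k) : minCount m alpha beta k r = 0 := by
  simp [minCount, Nat.sub_eq_zero_of_le h, room]

theorem minCount_succ_succ_le (hb : Antitone beta) (k r : ℕ) :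
    minCount m alpha beta (k + 1) (r + 1) ≤ minCount m alpha beta k r := by
  rw [minCount, minCount, Nat.add_sub_add_right]
  exact min_le_min_right _ (hb k.le_succ)

theorem minEnd_succ (k r : ℕ) : minEnd m alpha beta (k + 1) r = minEnd m alpha beta k r +
    (minCount m alpha beta k (r + 1) - minCount m alpha beta k r) := by
  rw [minEnd, minEnd, Finset.sum_range_succ, add_assoc]

theorem minEnd_mono (r : ℕ) : Monotone fun k => minEnd m alpha beta k r :=
  monotone_nat_of_le_succ fun k => by simp only [minEnd_succ]; omega

theorem minEnd_eq_minShape {k r : ℕ} (h : r < k) :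
    minEnd m alpha beta k r = minShape m alpha beta r := by
  induction k, h using Nat.le_induction with
  | base => rfl
  | succ k hk ih =>
    rw [minEnd_succ, ih, minCount_eq_zero (k := k) (r := r + 1) hk]
    simp

theorem minEnd_le_minShape (k r : ℕ) : minEnd m alpha beta k r ≤ minShape m alpha beta r := by
  rw [← minEnd_eq_minShape (show r < max k (r + 1) by omega)]
  exact minEnd_mono r (le_max_left _ _)

theorem minEnd_interlace (ha : Antitone alpha) (ham : alpha 0 ≤ m) (hb : Antitone beta)
    (k r : ℕ) : minEnd m alpha beta (k + 1) (r + 1) ≤ minEnd m alpha beta k r := by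
  induction k with
  | zero =>
    have h1 := ha r.le_succ
    have h2 := ha (Nat.zero_le r)
    simp only [Nat.succ_eq_add_one] at h1
    simp only [minEnd, minCount, Finset.sum_range_succ, Finset.sum_range_zero, Nat.sub_zero, room]
    omega
  | succ k ih =>
    rw [minEnd_succ, minEnd_succ k r]
    have h1 := hb k.le_succ
    have h2 := room_mono (m := m) ha (show r - k ≤ r + 1 - k by omega)
    simp only [minCount, Nat.add_sub_add_right, show r + 1 + 1 - (k + 1) = r + 1 - k by omega]
    simp only [Nat.succ_eq_add_one] at h1
    omega

theorem minShape_antitone (ha : Antitone alpha) (ham : alpha 0 ≤ m) (hb : Antitone beta) :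
    Antitone (minShape m alpha beta) :=
  antitone_nat_of_succ_le fun r => minEnd_interlace ha ham hb (r + 1) r

theorem minCount_eq (ha : Antitone alpha) (hm : alpha m = 0) (hbm : ∀ k, beta k ≤ m) {k r : ℕ}
    (h : m + k < r) : minCount m alpha beta k r = beta k := by
  refine min_eq_left ?_
  obtain ⟨n, hn⟩ : ∃ n, r - k = n + 1 := ⟨r - k - 1, by omega⟩
  have := ha (show m ≤ n by omega)
  have := hbm k
  rw [hn, room]
  omega

theorem minShape_isPartition (ha : Antitone alpha) (ham : alpha 0 ≤ m) (hm : alpha m = 0)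
    (hb : Antitone beta) (hbm : ∀ k, beta k ≤ m) {K : ℕ} (hK : ∀ k, K ≤ k → beta k = 0) :
    IsPartition (minShape m alpha beta) := by
  refine ⟨minShape_antitone ha ham hb, m + K + 1, ?_⟩
  have h0 := ha (show m ≤ m + K + 1 by omega)
  rw [minShape, minEnd, Nat.add_eq_zero_iff]
  refine ⟨by omega, Finset.sum_eq_zero fun j _ => ?_⟩
  by_cases hj : j < K
  · rw [minCount_eq ha hm hbm (by omega), minCount_eq ha hm hbm (by omega), Nat.sub_self]
  · simp [minCount, hK j (by omega)]

theorem minShape_le (ha : Antitone alpha) (ham : alpha 0 ≤ m) (hb : Antitone beta) (r : ℕ) :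
    minShape m alpha beta r ≤ m := by
  refine (minShape_antitone ha ham hb (Nat.zero_le r)).trans ?_
  have : minCount m alpha beta 0 (0 + 1) ≤ m - alpha 0 := min_le_right _ _
  rw [minShape, minEnd, Finset.sum_range_one]
  omega

theorem le_minShape (r : ℕ) : alpha r ≤ minShape m alpha beta r := Nat.le_add_right _ _

theorem sum_minCount_sub (ha : Antitone alpha) (k R : ℕ) :
    ∑ r ∈ Finset.range R, (minCount m alpha beta k (r + 1) - minCount m alpha beta k r) =
      minCount m alpha beta k R := by
  rw [Finset.sum_range_tsub (minCount_mono ha k), minCount_eq_zero (Nat.zero_le k), Nat.sub_zero]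

theorem sum_minShape_sub (ha : Antitone alpha) :
    ∑ r ∈ Finset.range m, (minShape m alpha beta r - alpha r) =
      ∑ k ∈ Finset.range m, minCount m alpha beta k m := by
  rw [← Finset.sum_congr rfl fun k _ => sum_minCount_sub ha k m, Finset.sum_comm]
  refine Finset.sum_congr rfl fun r hr => ?_
  rw [← minEnd_eq_minShape (Finset.mem_range.1 hr), minEnd, Nat.add_sub_cancel_left]

open Classical in
/-- The entries of the minimal tableau. -/
noncomputable def minEntry (m : ℕ) (alpha beta : ℕ → ℕ) (r c : ℕ) : ℕ :=
  if inShape (minShape m alpha beta) alpha r c then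
    Nat.findGreatest (fun k => minEnd m alpha beta k r ≤ c) r + 1 else 0

theorem minEntry_spec {r c : ℕ} (h : inShape (minShape m alpha beta) alpha r c) :
    ∃ k, minEntry m alpha beta r c = k + 1 ∧
      minEnd m alpha beta k r ≤ c ∧ c < minEnd m alpha beta (k + 1) r := by
  classical
  refine ⟨_, if_pos h, ?_, ?_⟩
  · exact Nat.findGreatest_spec (P := fun k => minEnd m alpha beta k r ≤ c) (Nat.zero_le r)
      (by simpa [minEnd] using h.1)
  · set e := Nat.findGreatest (fun k => minEnd m alpha beta k r ≤ c) r with he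
    by_contra! hc
    rcases Nat.lt_or_ge e r with hlt | hge
    · exact Nat.findGreatest_is_greatest (P := fun k => minEnd m alpha beta k r ≤ c)
        (Nat.lt_succ_self e) hlt hc
    · rw [minEnd_eq_minShape (by omega)] at hc
      exact absurd h.2 (by omega)

theorem inShape_and_minEntry_iff {r c k : ℕ} :
    (inShape (minShape m alpha beta) alpha r c ∧ minEntry m alpha beta r c = k + 1) ↔
      minEnd m alpha beta k r ≤ c ∧ c < minEnd m alpha beta (k + 1) r := by
  constructor
  · rintro ⟨h, hk⟩
    obtain ⟨k', h1, h2⟩ := minEntry_spec h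
    obtain rfl : k' = k := by omega
    exact h2
  · rintro ⟨h1, h2⟩
    have hs : inShape (minShape m alpha beta) alpha r c :=
      ⟨(Nat.le_add_right _ _).trans h1, h2.trans_le (minEnd_le_minShape _ _)⟩
    refine ⟨hs, ?_⟩
    obtain ⟨k', h3, h4, h5⟩ := minEntry_spec hs
    have h6 : k < k' + 1 := (minEnd_mono r).reflect_lt (h1.trans_lt h5)
    have h7 : k' < k + 1 := (minEnd_mono r).reflect_lt (h4.trans_lt h2)
    omega

theorem card_minEntry (ha : Antitone alpha) (k R : ℕ) :
    Nat.card {p : ℕ × ℕ // p.1 < R ∧ minEnd m alpha beta k p.1 ≤ p.2 ∧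
      p.2 < minEnd m alpha beta (k + 1) p.1} = minCount m alpha beta k R := by
  rw [card_cells_between, ← sum_minCount_sub ha]
  refine Finset.sum_congr rfl fun r _ => ?_
  rw [minEnd_succ, Nat.add_sub_cancel_left]

theorem minEntry_lt_of_lt_row (ha : Antitone alpha) (ham : alpha 0 ≤ m) (hb : Antitone beta)
    {r₁ r₂ c : ℕ} (hr : r₁ < r₂) (h₁ : inShape (minShape m alpha beta) alpha r₁ c)
    (h₂ : inShape (minShape m alpha beta) alpha r₂ c) :
    minEntry m alpha beta r₁ c < minEntry m alpha beta r₂ c := by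
  induction r₂, hr using Nat.le_induction with
  | base =>
    obtain ⟨k₁, e₁, l₁, u₁⟩ := minEntry_spec h₁
    obtain ⟨k₂, e₂, l₂, u₂⟩ := minEntry_spec h₂
    have := minEnd_interlace ha ham hb k₂ r₁
    have : k₁ < k₂ := (minEnd_mono r₁).reflect_lt (l₁.trans_lt (u₂.trans_le this))
    omega
  | succ r hr ih =>
    have h : inShape (minShape m alpha beta) alpha r c :=
      ⟨(ha (Nat.le_of_lt hr)).trans h₁.1,
        h₂.2.trans_le (minShape_antitone ha ham hb r.le_succ)⟩
    refine (ih h).trans ?_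
    obtain ⟨k₁, e₁, l₁, u₁⟩ := minEntry_spec h
    obtain ⟨k₂, e₂, l₂, u₂⟩ := minEntry_spec h₂
    have := minEnd_interlace ha ham hb k₂ r
    have : k₁ < k₂ := (minEnd_mono r).reflect_lt (l₁.trans_lt (u₂.trans_le this))
    omega

/-- The minimal Littlewood–Richardson tableau: the first `r` rows contain as many entries
`k + 1` as the lattice condition and the room to the right of `alpha` allow. -/
noncomputable def minTableau (ha : Antitone alpha) (ham : alpha 0 ≤ m) (hm : alpha m = 0)
    (hb : Antitone beta) (hbm : ∀ k, beta k ≤ m) {K : ℕ} (hK : ∀ k, K ≤ k → beta k = 0) :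
    LRTableau (minShape m alpha beta) alpha beta where
  entry := minEntry m alpha beta
  zero_outside _ _ h := if_neg h
  one_le _ _ h := by
    obtain ⟨k, hk, -⟩ := minEntry_spec h
    omega
  row_weak r c₁ c₂ hc h₁ h₂ := by
    obtain ⟨k₁, e₁, l₁, u₁⟩ := minEntry_spec h₁
    obtain ⟨k₂, e₂, l₂, u₂⟩ := minEntry_spec h₂
    have : k₁ < k₂ + 1 := (minEnd_mono r).reflect_lt (l₁.trans_lt (hc.trans_lt u₂))
    omega
  col_strict _ _ _ hr h₁ h₂ := minEntry_lt_of_lt_row ha ham hb hr h₁ h₂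
  content k := by
    rw [← minCount_eq ha hm hbm (Nat.lt_succ_self (m + k)), ← card_minEntry ha]
    refine Nat.card_congr (Equiv.subtypeEquivRight fun p => ?_)
    rw [inShape_and_minEntry_iff, iff_and_self]
    rintro ⟨h1, h2⟩
    by_contra! h
    have h3 := (h1.trans_lt h2)
    rw [minEnd_succ, minCount_eq ha hm hbm (by omega), minCount_eq ha hm hbm (by omega)] at h3
    omega
  lattice r c k h := by
    obtain ⟨S, hS⟩ := exists_finset_inShape
      (minShape_isPartition ha ham hm hb hbm hK) alpha
    have hfin : {p : ℕ × ℕ | inShape (minShape m alpha beta) alpha p.1 p.2}.Finite :=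
      S.finite_toSet.subset fun p hp => (hS p).2 hp
    calc Nat.card {p : ℕ × ℕ // inShape (minShape m alpha beta) alpha p.1 p.2 ∧
          (p.1 < r ∨ (p.1 = r ∧ c ≤ p.2)) ∧ minEntry m alpha beta p.1 p.2 = k + 2}
        ≤ Nat.card {p : ℕ × ℕ // p.1 < r + 1 ∧ minEnd m alpha beta (k + 1) p.1 ≤ p.2 ∧
          p.2 < minEnd m alpha beta (k + 1 + 1) p.1} := by
          refine Nat.card_mono (hfin.subset fun p hp => ?_) fun p hp => ?_
          · exact (inShape_and_minEntry_iff.2 hp.2).1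
          · exact ⟨by have := hp.2.1; omega, inShape_and_minEntry_iff.1 ⟨hp.1, hp.2.2⟩⟩
      _ ≤ Nat.card {p : ℕ × ℕ // p.1 < r ∧ minEnd m alpha beta k p.1 ≤ p.2 ∧
          p.2 < minEnd m alpha beta (k + 1) p.1} := by
          rw [card_minEntry ha, card_minEntry ha]
          exact minCount_succ_succ_le hb k r
      _ ≤ _ := by
          refine Nat.card_mono (hfin.subset fun p hp => hp.1) fun p hp => ?_
          obtain ⟨h1, h2⟩ := inShape_and_minEntry_iff.2 hp.2
          exact ⟨h1, Or.inl hp.1, h2⟩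

end MinTableau

theorem room_complP {m k : ℕ} {f : ℕ → ℕ} (hk : k < m) (hf : f k ≤ m) :
    room m (complP m f) (m - k) = f k := by
  rw [show m - k = m - k - 1 + 1 by omega, room, complP, if_pos (by omega),
    show m - 1 - (m - k - 1) = k by omega]
  omega

namespace IsPartition

variable {f : ℕ → ℕ}

theorem pos_iff (hf : IsPartition f) (j : ℕ) : 0 < f j ↔ j < plen f := by
  have hz : f (plen f) = 0 := Nat.sInf_mem (s := {n | f n = 0}) hf.2
  constructor
  · intro h
    by_contra! hj
    have := hf.1 hj
    omega
  · intro h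
    exact Nat.pos_of_ne_zero (Nat.notMem_of_lt_sInf (s := {n | f n = 0}) h)

theorem finite_lt (hf : IsPartition f) (j : ℕ) : {i | j < f i}.Finite :=
  (Set.finite_Iio (plen f)).subset fun _ hi => (hf.pos_iff _).1 (Nat.zero_lt_of_lt hi)

theorem conjP_antitone (hf : IsPartition f) : Antitone (conjP f) := fun _ _ h =>
  Nat.card_mono (hf.finite_lt _) fun _ hi => lt_of_le_of_lt h hi

theorem conjP_zero (hf : IsPartition f) : conjP f 0 = plen f := by
  rw [conjP, Nat.subtype_card (Finset.range (plen f)) (fun j => by simp [hf.pos_iff]),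
    Finset.card_range]

theorem conjP_eq_zero (hf : IsPartition f) {k : ℕ} (hk : f 0 ≤ k) : conjP f k = 0 := by
  have : IsEmpty {i : ℕ // k < f i} := ⟨fun i => by
    have := hf.1 (Nat.zero_le i.1)
    have := i.2
    omega⟩
  exact Nat.card_of_isEmpty

theorem appendOne (hf : IsPartition f) : IsPartition (addPart1 f) := by
  refine ⟨antitone_nat_of_succ_le fun n => ?_, plen f + 1, by simp [addPart1]⟩
  have h1 := hf.1 n.le_succ
  have h2 := (hf.pos_iff n).2
  simp only [addPart1]
  split_ifs <;> omega

theorem addPart1_eq (hf : IsPartition f) (j : ℕ) :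
    addPart1 f j = f j + if j = plen f then 1 else 0 := by
  have := hf.pos_iff j
  simp only [addPart1]
  split_ifs <;> omega

theorem conjP_addPart1 (hf : IsPartition f) {k : ℕ} (hk : k ≠ 0) :
    conjP (addPart1 f) k = conjP f k := by
  refine Nat.card_congr (Equiv.subtypeEquivRight fun j => ?_)
  have := hf.pos_iff j
  rw [hf.addPart1_eq]
  split_ifs <;> omega

theorem plen_addPart1 (hf : IsPartition f) : plen (addPart1 f) = plen f + 1 := by
  refine le_antisymm (Nat.sInf_le (by simp [addPart1])) ?_
  refine ((hf.appendOne).pos_iff (plen f)).1 ?_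
  simp [hf.addPart1_eq]

end IsPartition

/-- A nonempty partition with at least as many parts as its first part is not covered by the
partition obtained by appending a part equal to `1`. -/
theorem not_covers_addPart1 {nu : ℕ → ℕ} (hnu : IsPartition nu) (hne : nu 0 ≠ 0)
    (hlen : nu 0 ≤ plen nu) : ¬ Covers (addPart1 nu) nu := by
  intro hcov
  have hmu := hnu.appendOne
  have hlpos : 0 < plen nu := (hnu.pos_iff 0).1 (by omega)
  have hmu0 : addPart1 nu 0 = nu 0 := by rw [hnu.addPart1_eq, if_neg (by omega), add_zero]
  obtain ⟨m, hm⟩ : ∃ m, m = nu 0 + (plen nu + 1) := ⟨_, rfl⟩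
  have ha := complP_antitone m hnu.1
  have ham : complP m nu 0 ≤ m := by simp only [complP]; split_ifs <;> omega
  have ham' : complP m nu m = 0 := by simp [complP]
  have hb := hnu.conjP_antitone
  have hbm (k : ℕ) : conjP nu k ≤ m := by
    have := hb (Nat.zero_le k)
    rw [hnu.conjP_zero] at this
    omega
  have hK (k : ℕ) (hk : nu 0 ≤ k) : conjP nu k = 0 := hnu.conjP_eq_zero hk
  have hlam := minShape_isPartition ha ham ham' hb hbm hK
  specialize hcov m (by rw [hmu0, hnu.plen_addPart1]; omega) _ hlam
  have : Finite (LRTableau (minShape m (complP m nu) (conjP nu)) (complP m nu) (conjP nu)) :=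
    LRTableau.finite hlam hK
  have : Nonempty (LRTableau (minShape m (complP m nu) (conjP nu)) (complP m nu) (conjP nu)) :=
    ⟨minTableau ha ham ham' hb hbm hK⟩
  rw [LRcoeff, if_pos (show subP _ _ from le_minShape)] at hcov
  have hpos := Nat.card_pos.trans_le hcov
  rw [LRcoeff] at hpos
  split_ifs at hpos with hsub
  · obtain ⟨⟨T⟩, -⟩ := Nat.card_pos_iff.1 hpos
    have hle := T.card_cells_le hlam hmu.1 (by omega) (minShape_le ha ham hb)
      fun k hk => hmu.conjP_eq_zero (by omega)
    have hlt : ∑ r ∈ Finset.range m, (minShape m (complP m nu) (conjP nu) r - complP m nu r) <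
        ∑ r ∈ Finset.range m,
          (minShape m (complP m nu) (conjP nu) r - complP m (addPart1 nu) r) := by
      refine Finset.sum_lt_sum (fun r hr => ?_) ⟨m - 1 - plen nu, ?_, ?_⟩
      · have := hnu.addPart1_eq (m - 1 - r)
        simp only [complP]
        split_ifs <;> omega
      · simp only [Finset.mem_range]; omega
      · have h1 := hnu.addPart1_eq (plen nu)
        have h2 := le_minShape (m := m) (alpha := complP m nu) (beta := conjP nu)
          (m - 1 - plen nu)
        have h3 := hnu.pos_iff (plen nu)
        rw [if_pos rfl] at h1
        simp only [complP] at h2 ⊢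
        rw [if_pos (by omega), show m - 1 - (m - 1 - plen nu) = plen nu by omega] at h2 ⊢
        rw [if_pos (by omega)]
        omega
    rw [sum_minShape_sub ha] at hlt
    refine absurd (hlt.trans_le hle) (not_lt.2 (Finset.sum_le_sum fun k hk => ?_))
    have hkm := Finset.mem_range.1 hk
    have hk0 := hnu.1 (Nat.zero_le k)
    rw [minCount, room_complP hkm (by omega)]
    rcases eq_or_ne k 0 with rfl | hk'
    · rw [hnu.conjP_zero, hmu0]
      omega
    · rw [hnu.conjP_addPart1 hk', hnu.addPart1_eq]
      split_ifs with hkl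
      · rw [hK k (by omega)]
        omega
      · rfl
  · exact absurd hpos (lt_irrefl 0)

/-- a nonempty type-1 partition `ν` containing the rectangle
`(ν₁^{ν₁ - 1})` is not covered by `(ν, 1)`. -/
theorem type1_large_rectangle_not_covered_by_column (nu : ℕ → ℕ)
    (h1 : Type1 nu) (hne : nu 0 ≠ 0)
    (hrect : subP (fun j => if j < nu 0 - 1 then nu 0 else 0) nu) :
    ¬ Covers (addPart1 nu) nu := by
  refine not_covers_addPart1 h1.1 hne (le_of_lt ((h1.1.pos_iff _).1 ?_))
  have := h1.2 (nu 0)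
  simp only [betaShape] at this
  split_ifs at this <;> omega
end

section
/- Let ν be a nonempty partition of type 1 such that ν contains the rectangle (ν₁^{ν₁−1}) (the partition with ν₁ − 1 parts equal to ν₁). If μ is a partition with ν ⊆ μ, |μ| = |ν| + 1, and μ ≠ ν + (1), then μ does not cover ν. -/
theorem lt_conjP_iff {f : ℕ → ℕ} (hf : IsPartition f) (a x : ℕ) : a < conjP f x ↔ x < f a := by
  classical
  obtain ⟨N, hN⟩ := hf.2
  have hex : ∃ n, f n ≤ x := ⟨N, by omega⟩
  have hset : {i : ℕ | x < f i} = Set.Iio (Nat.find hex) := by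
    ext b
    simp only [Set.mem_ofPred_eq, Set.mem_Iio, Nat.lt_find_iff, not_le]
    exact ⟨fun h c hc => lt_of_lt_of_le h (hf.1 hc), fun h => h b le_rfl⟩
  have hcard : conjP f x = Nat.find hex := by
    change Nat.card ↥{i : ℕ | x < f i} = _
    rw [hset]
    simp
  have := Set.ext_iff.1 hset a
  rw [hcard]
  exact this.symm

theorem conjP_antitone {f : ℕ → ℕ} (hf : IsPartition f) : Antitone (conjP f) := by
  intro x y hxy
  by_contra! hlt
  have h1 := (lt_conjP_iff hf _ _).1 hlt
  have h2 := (lt_conjP_iff hf (conjP f x) x).not.1 (lt_irrefl _)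
  omega

theorem apply_plen {f : ℕ → ℕ} (hf : IsPartition f) : f (plen f) = 0 :=
  Nat.sInf_mem (s := {n | f n = 0}) hf.2

theorem psize_eq_sum_range {f : ℕ → ℕ} (hf : IsPartition f) {N : ℕ} (hN : plen f ≤ N) :
    psize f = ∑ j ∈ Finset.range N, f j := by
  refine Finset.sum_subset (Finset.range_mono hN) fun j _ hj => ?_
  have := hf.1 (not_lt.1 (Finset.mem_range.not.1 hj))
  have := apply_plen hf
  omega

/-- A partition containing `nu` with one more box adds that box to a single row. -/
theorem exists_added_row {nu mu : ℕ → ℕ} (hnu : IsPartition nu) (hmu : IsPartition mu)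
    (hsub : subP nu mu) (hsz : psize mu = psize nu + 1) :
    ∃ r, mu r = nu r + 1 ∧ ∀ j, j ≠ r → mu j = nu j := by
  set N := max (plen nu) (plen mu)
  have key : ∀ K, N ≤ K → ∑ j ∈ Finset.range K, (mu j - nu j) = 1 := by
    intro K hK
    have h1 := psize_eq_sum_range hnu ((le_max_left _ _).trans hK)
    have h2 := psize_eq_sum_range hmu ((le_max_right _ _).trans hK)
    rw [Finset.sum_tsub_distrib _ fun j _ => hsub j]
    omega
  obtain ⟨r, hr, hrne⟩ : ∃ r ∈ Finset.range N, mu r - nu r ≠ 0 :=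
    Finset.exists_ne_zero_of_sum_ne_zero (by rw [key N le_rfl]; exact one_ne_zero)
  have hrN := Finset.mem_range.1 hr
  refine ⟨r, ?_, fun j hj => ?_⟩
  · have h1 : mu r - nu r ≤ 1 := key N le_rfl ▸
      Finset.single_le_sum (f := fun j => mu j - nu j) (fun _ _ => Nat.zero_le _) hr
    have := hsub r
    omega
  · have hK := key (max N (j + 1)) (le_max_left _ _)
    have hle : ∑ l ∈ {r, j}, (mu l - nu l) ≤ ∑ l ∈ Finset.range (max N (j + 1)), (mu l - nu l) := by
      refine Finset.sum_le_sum_of_subset fun l hl => ?_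
      simp only [Finset.mem_insert, Finset.mem_singleton] at hl
      simp only [Finset.mem_range]
      omega
    rw [Finset.sum_pair (Ne.symm hj)] at hle
    have := hsub j
    omega

theorem shape_finite {lam : ℕ → ℕ} (hlam : IsPartition lam) (alpha : ℕ → ℕ) :
    {p : ℕ × ℕ | inShape lam alpha p.1 p.2}.Finite := by
  obtain ⟨N, hN⟩ := hlam.2
  refine ((Set.finite_lt_nat N).prod (Set.finite_lt_nat (lam 0))).subset fun p hp => ?_
  have h1 : p.2 < lam p.1 := hp.2
  refine ⟨?_, lt_of_lt_of_le h1 (hlam.1 (Nat.zero_le _))⟩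
  by_contra hlt
  have := hlam.1 (not_lt.1 hlt)
  omega

theorem cells_finite {lam : ℕ → ℕ} (hlam : IsPartition lam) (alpha : ℕ → ℕ) (P : ℕ × ℕ → Prop) :
    Finite {p : ℕ × ℕ // inShape lam alpha p.1 p.2 ∧ P p} :=
  ((shape_finite hlam alpha).subset fun _ hp => hp.1 :
    {p : ℕ × ℕ | inShape lam alpha p.1 p.2 ∧ P p}.Finite).to_subtype

theorem card_cells_mono {lam : ℕ → ℕ} (hlam : IsPartition lam) {alpha : ℕ → ℕ}
    {P Q : ℕ × ℕ → Prop} (h : ∀ p, inShape lam alpha p.1 p.2 → P p → Q p) :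
    Nat.card {p : ℕ × ℕ // inShape lam alpha p.1 p.2 ∧ P p} ≤
      Nat.card {p : ℕ × ℕ // inShape lam alpha p.1 p.2 ∧ Q p} := by
  have := cells_finite hlam alpha Q
  exact Nat.card_le_card_of_injective
    (fun p => ⟨p.1, p.2.1, h p.1 p.2.1 p.2.2⟩) fun p q hpq => Subtype.ext (congrArg (·.1) hpq)

/-- The number of entries equal to `k + 1` in the first `a` rows. -/
noncomputable def rowsCount {lam alpha beta : ℕ → ℕ} (T : LRTableau lam alpha beta) (k a : ℕ) : ℕ :=
  Nat.card {p : ℕ × ℕ // inShape lam alpha p.1 p.2 ∧ p.1 < a ∧ T.entry p.1 p.2 = k + 1}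

theorem rowsCount_zero {lam alpha beta : ℕ → ℕ} (T : LRTableau lam alpha beta) (k : ℕ) :
    rowsCount T k 0 = 0 := by
  have : IsEmpty {p : ℕ × ℕ // inShape lam alpha p.1 p.2 ∧ p.1 < 0 ∧ T.entry p.1 p.2 = k + 1} :=
    ⟨fun p => absurd p.2.2.1 (Nat.not_lt_zero _)⟩
  exact Nat.card_of_isEmpty

theorem rowsCount_succ_le {lam alpha beta : ℕ → ℕ} (hlam : IsPartition lam)
    (T : LRTableau lam alpha beta) (a k : ℕ) : rowsCount T (k + 1) (a + 1) ≤ rowsCount T k a := by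
  classical
  induction a with
  | zero =>
    by_cases hex : ∃ c, inShape lam alpha 0 c ∧ T.entry 0 c = k + 2
    · have hmin := Nat.find_spec hex
      refine (card_cells_mono hlam ?_).trans
        ((T.lattice 0 (Nat.find hex) k hmin.1).trans (card_cells_mono hlam ?_))
      · rintro ⟨b, x⟩ hs ⟨hb, he⟩
        obtain rfl : b = 0 := by simpa using hb
        exact ⟨Or.inr ⟨rfl, Nat.find_min' hex ⟨hs, he⟩⟩, he⟩
      · rintro ⟨b, x⟩ hs ⟨hb | ⟨rfl, hb⟩, he⟩
        · exact ⟨hb, he⟩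
        · have := T.row_weak 0 _ x hb hmin.1 hs
          simp only at he
          omega
    · refine (card_cells_mono hlam (Q := fun p => p.1 < 0 ∧ T.entry p.1 p.2 = k + 2) ?_).trans
        ((rowsCount_zero T (k + 1)).le.trans (Nat.zero_le _))
      rintro ⟨b, x⟩ hs ⟨hb, he⟩
      obtain rfl : b = 0 := by simpa using hb
      exact absurd ⟨x, hs, he⟩ hex
  | succ a ih =>
    by_cases hex : ∃ c, inShape lam alpha (a + 1) c ∧ T.entry (a + 1) c = k + 2
    · have hmin := Nat.find_spec hex
      refine (card_cells_mono hlam ?_).trans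
        ((T.lattice (a + 1) (Nat.find hex) k hmin.1).trans (card_cells_mono hlam ?_))
      · rintro ⟨b, x⟩ hs ⟨hb, he⟩
        rcases Nat.lt_succ_iff_lt_or_eq.1 hb with h | h
        · exact ⟨Or.inl h, he⟩
        · simp only at h
          subst h
          exact ⟨Or.inr ⟨rfl, Nat.find_min' hex ⟨hs, he⟩⟩, he⟩
      · rintro ⟨b, x⟩ hs ⟨hb | ⟨rfl, hb⟩, he⟩
        · exact ⟨hb, he⟩
        · have := T.row_weak _ _ x hb hmin.1 hs
          simp only at he
          omega
    · refine (card_cells_mono hlam (Q := fun p => p.1 < a + 1 ∧ T.entry p.1 p.2 = k + 2) ?_).trans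
        (ih.trans (card_cells_mono hlam fun p _ hp => ⟨Nat.lt_succ_of_lt hp.1, hp.2⟩))
      rintro ⟨b, x⟩ hs ⟨hb, he⟩
      rcases Nat.lt_succ_iff_lt_or_eq.1 hb with h | h
      · exact ⟨h, he⟩
      · simp only at h
        subst h
        exact absurd ⟨x, hs, he⟩ hex

theorem rowsCount_add_le {lam alpha beta : ℕ → ℕ} (hlam : IsPartition lam)
    (T : LRTableau lam alpha beta) (k a j : ℕ) :
    rowsCount T (k + j) (a + j) ≤ rowsCount T k a := by
  induction j with
  | zero => exact le_rfl
  | succ j ih => exact (rowsCount_succ_le hlam T (a + j) (k + j)).trans ih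

theorem entry_le_row {lam alpha beta : ℕ → ℕ} (hlam : IsPartition lam)
    (T : LRTableau lam alpha beta) {r c : ℕ} (hs : inShape lam alpha r c) :
    T.entry r c ≤ r + 1 := by
  by_contra! hlt
  obtain ⟨k, hk⟩ : ∃ k, T.entry r c = k + (r + 1) + 1 := ⟨T.entry r c - (r + 2), by omega⟩
  have h := rowsCount_add_le hlam T k 0 (r + 1)
  rw [rowsCount_zero, Nat.zero_add, Nat.le_zero, rowsCount] at h
  have := cells_finite hlam alpha fun p => p.1 < r + 1 ∧ T.entry p.1 p.2 = k + (r + 1) + 1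
  rw [Finite.card_eq_zero_iff] at h
  exact h.false ⟨(r, c), hs, Nat.lt_succ_self r, hk⟩

theorem finite_LRTableau {lam : ℕ → ℕ} (hlam : IsPartition lam) (alpha beta : ℕ → ℕ) :
    Finite (LRTableau lam alpha beta) := by
  have := (shape_finite hlam alpha).to_subtype
  refine Finite.of_injective
    (fun T : LRTableau lam alpha beta =>
      fun p : {p : ℕ × ℕ | inShape lam alpha p.1 p.2} =>
        (⟨T.entry p.1.1 p.1.2, Nat.lt_succ_of_le (entry_le_row hlam T p.2)⟩ : Fin (p.1.1 + 2)))
    fun T U h => ?_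
  have hentry : T.entry = U.entry := by
    funext r c
    by_cases hs : inShape lam alpha r c
    · simpa using congrFun h ⟨(r, c), hs⟩
    · rw [T.zero_outside r c hs, U.zero_outside r c hs]
  cases T
  cases U
  cases hentry
  rfl

theorem LRcoeff_pos {lam alpha beta : ℕ → ℕ} (hlam : IsPartition lam) (hsub : subP alpha lam)
    (h : Nonempty (LRTableau lam alpha beta)) : 0 < LRcoeff lam alpha beta := by
  have := finite_LRTableau hlam alpha beta
  rw [LRcoeff, if_pos hsub]
  exact Nat.card_pos

theorem LRcoeff_eq_zero {lam alpha beta : ℕ → ℕ} (h : LRTableau lam alpha beta → False) :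
    LRcoeff lam alpha beta = 0 := by
  have : IsEmpty (LRTableau lam alpha beta) := ⟨h⟩
  rw [LRcoeff]
  split_ifs
  · exact Nat.card_of_isEmpty
  · rfl

/-- To build an LR tableau it suffices to match every entry `v ≥ 2` injectively with an entry
`v - 1` in a higher row. -/
theorem nonempty_LRTableau {lam alpha beta : ℕ → ℕ} (hlam : IsPartition lam) (e : ℕ → ℕ → ℕ)
    (M : ℕ × ℕ → ℕ × ℕ)
    (one_le : ∀ r c, inShape lam alpha r c → 1 ≤ e r c)
    (row_weak : ∀ r c₁ c₂, c₁ ≤ c₂ → inShape lam alpha r c₁ → inShape lam alpha r c₂ →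
      e r c₁ ≤ e r c₂)
    (col_strict : ∀ r₁ r₂ c, r₁ < r₂ → inShape lam alpha r₁ c → inShape lam alpha r₂ c →
      e r₁ c < e r₂ c)
    (content : ∀ k, Nat.card {p : ℕ × ℕ // inShape lam alpha p.1 p.2 ∧ e p.1 p.2 = k + 1} = beta k)
    (hM : ∀ r c, inShape lam alpha r c → 2 ≤ e r c →
      inShape lam alpha (M (r, c)).1 (M (r, c)).2 ∧ (M (r, c)).1 < r ∧
        e (M (r, c)).1 (M (r, c)).2 + 1 = e r c)
    (hinj : ∀ r c r' c', inShape lam alpha r c → inShape lam alpha r' c' → 2 ≤ e r c →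
      e r c = e r' c' → M (r, c) = M (r', c') → (r, c) = (r', c')) :
    Nonempty (LRTableau lam alpha beta) := by
  classical
  have hval : ∀ {r c}, inShape lam alpha r c →
      (if inShape lam alpha r c then e r c else 0) = e r c := fun hs => if_pos hs
  refine ⟨⟨fun r c => if inShape lam alpha r c then e r c else 0, fun r c hs => if_neg hs, ?_, ?_,
    ?_, ?_, ?_⟩⟩
  · intro r c hs
    rw [hval hs]
    exact one_le r c hs
  · intro r c₁ c₂ h h1 h2
    rw [hval h1, hval h2]
    exact row_weak r c₁ c₂ h h1 h2
  · intro r₁ r₂ c h h1 h2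
    simp only [hval h1, hval h2]
    exact col_strict r₁ r₂ c h h1 h2
  · intro k
    rw [← content k]
    refine Nat.card_congr (Equiv.subtypeEquivRight fun p => and_congr_right fun hs => ?_)
    rw [hval hs]
  · intro r c k hs
    have := cells_finite hlam alpha fun p => (p.1 < r ∨ (p.1 = r ∧ c ≤ p.2)) ∧
      (if inShape lam alpha p.1 p.2 then e p.1 p.2 else 0) = k + 1
    refine Nat.card_le_card_of_injective (fun p => ⟨M p.1, ?_⟩) ?_
    · obtain ⟨⟨b, x⟩, hp, hbx, he⟩ := p
      simp only at hp hbx he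
      rw [hval hp] at he
      obtain ⟨h1, h2, h3⟩ := hM b x hp (by omega)
      have hlt : (M (b, x)).1 < r := by omega
      refine ⟨h1, Or.inl hlt, ?_⟩
      rw [hval h1]
      omega
    · rintro ⟨⟨b, x⟩, hp, hbx, he⟩ ⟨⟨b', x'⟩, hp', hbx', he'⟩ h
      simp only at hp hp' he he'
      rw [hval hp] at he
      rw [hval hp'] at he'
      exact Subtype.ext (hinj b x b' x' hp hp' (by omega) (by omega) (congrArg (·.1) h))

theorem card_subtype_eq_of_param {α : Type*} {P : α → Prop} {n : ℕ} (f : ℕ → α)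
    (hP : ∀ s < n, P (f s)) (hinj : ∀ s < n, ∀ t < n, f s = f t → s = t)
    (hsurj : ∀ p, P p → ∃ s < n, f s = p) : Nat.card {p // P p} = n := by
  have hb : Function.Bijective (fun s : Fin n => (⟨f s, hP s s.2⟩ : {p // P p})) := by
    refine ⟨fun s t h => Fin.ext (hinj s s.2 t t.2 (congrArg (·.1) h)), fun p => ?_⟩
    obtain ⟨s, hs, h⟩ := hsurj p.1 p.2
    exact ⟨⟨s, hs⟩, Subtype.ext h⟩
  rw [← Nat.card_eq_of_bijective _ hb, Nat.card_fin]

section SquareAtCorner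

/-- `nu` with the boxes in rows `c - 1, …, i - 2` and columns `≥ c` removed. -/
def cornerEta (nu : ℕ → ℕ) (i c : ℕ) : ℕ → ℕ := fun a => if c ≤ a + 1 ∧ a + 1 < i then c else nu a

/-- The conjugate of `cornerEta`. -/
noncomputable def cornerGamma (nu : ℕ → ℕ) (i c : ℕ) : ℕ → ℕ :=
  fun j => if j < c then conjP nu j else if j < i then c - 1 else 0

/-- The complement of `cornerEta` in `(m^m)`, with its conjugate added on the right. -/
noncomputable def cornerLam (nu : ℕ → ℕ) (i c m : ℕ) : ℕ → ℕ :=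
  fun R => if R < m then m - cornerEta nu i c (m - 1 - R) + cornerGamma nu i c R else 0

variable {nu : ℕ → ℕ} {i c m : ℕ}

theorem cornerLam_isPartition (hnu : IsPartition nu) (hrow : ∀ a, a + 1 < i → nu a = i)
    (hc : nu (i - 1) = c) (hci : c < i) : IsPartition (cornerLam nu i c m) := by
  have heta : ∀ a, cornerEta nu i c (a + 1) ≤ cornerEta nu i c a := by
    intro a
    have h1 := hnu.1 (Nat.le_add_right a 1)
    have h2 := hrow a
    have h3 := hrow (a + 1)
    unfold cornerEta
    by_cases ha : a + 1 = i - 1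
    · rw [ha, hc]
      split_ifs <;> omega
    · split_ifs <;> omega
  have hgam : ∀ j, cornerGamma nu i c (j + 1) ≤ cornerGamma nu i c j := by
    intro j
    have h1 := conjP_antitone hnu (Nat.le_add_right j 1)
    have h2 := (lt_conjP_iff hnu (i - 1) j)
    rw [hc] at h2
    unfold cornerGamma
    split_ifs <;> omega
  refine ⟨antitone_nat_of_succ_le fun R => ?_, m, by simp [cornerLam]⟩
  have h1 := hgam R
  have h2 := heta (m - 1 - (R + 1))
  unfold cornerLam
  by_cases hR : R + 1 < m
  · rw [show m - 1 - (R + 1) + 1 = m - 1 - R by omega] at h2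
    rw [if_pos hR, if_pos (by omega)]
    omega
  · rw [if_neg hR]
    omega

theorem subP_cornerLam (hrow : ∀ a, a + 1 < i → nu a = i) (hci : c < i) :
    subP (complP m nu) (cornerLam nu i c m) := by
  intro R
  have := hrow (m - 1 - R)
  simp only [complP, cornerLam, cornerEta]
  split_ifs <;> omega

theorem corner_row (hnu : IsPartition nu) (h0 : nu 0 = i)
    (hc : nu (i - 1) = c) (hc1 : 1 ≤ c) (hm : i + conjP nu 0 ≤ m) {R : ℕ} (hR : R < i) :
    cornerLam nu i c m R = m + cornerGamma nu i c R ∧ nu (m - 1 - R) = 0 := by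
  have h1 : i - 1 < conjP nu 0 := (lt_conjP_iff hnu _ _).2 (by omega)
  have h2 : nu (m - 1 - R) = 0 := by
    have := (lt_conjP_iff hnu (m - 1 - R) 0)
    omega
  refine ⟨?_, h2⟩
  rw [cornerLam, if_pos (by omega), cornerEta, if_neg (by omega), h2]
  omega

theorem corner_shape (hnu : IsPartition nu) (h0 : nu 0 = i) (hrow : ∀ a, a + 1 < i → nu a = i)
    (hc : nu (i - 1) = c) (hc1 : 1 ≤ c) (hci : c < i) (hm : i + conjP nu 0 ≤ m) (R C : ℕ) :
    inShape (cornerLam nu i c m) (complP m nu) R C ↔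
      (R < i ∧ m ≤ C ∧ C < m + cornerGamma nu i c R) ∨
        (m < R + i ∧ R + c ≤ m ∧ m ≤ C + i ∧ C + c < m) := by
  have hL : i - 1 < conjP nu 0 := (lt_conjP_iff hnu _ _).2 (by omega)
  unfold inShape complP
  by_cases hR : R < i
  · obtain ⟨h1, h2⟩ := corner_row hnu h0 hc hc1 hm hR
    rw [h1, h2, if_pos (by omega)]
    omega
  · by_cases hRm : R < m
    · have hle : nu (m - 1 - R) ≤ i := h0 ▸ hnu.1 (Nat.zero_le _)
      have h2 := hrow (m - 1 - R)
      have h3 : i ≤ m - 1 - R + 1 → nu (m - 1 - R) ≤ c := fun h => hc ▸ hnu.1 (by omega)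
      have h4 : cornerGamma nu i c R = 0 := by
        rw [cornerGamma, if_neg (by omega), if_neg hR]
      rw [if_pos hRm, cornerLam, if_pos hRm, cornerEta, h4]
      split_ifs <;> omega
    · rw [if_neg hRm, cornerLam, if_neg hRm]
      omega

theorem corner_tableau (hnu : IsPartition nu) (h0 : nu 0 = i)
    (hrow : ∀ a, a + 1 < i → nu a = i)
    (hc : nu (i - 1) = c) (hc1 : 1 ≤ c) (hci : c < i) (hm : i + conjP nu 0 ≤ m) :
    Nonempty (LRTableau (cornerLam nu i c m) (complP m nu) (conjP nu)) := by
  have hL : i - 1 < conjP nu 0 := (lt_conjP_iff hnu _ _).2 (by omega)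
  have hconj : ∀ k, c ≤ k → k < i → conjP nu k = i - 1 := by
    intro k hk hki
    have h1 := lt_conjP_iff hnu (i - 1) k
    have h2 := lt_conjP_iff hnu (i - 2) k
    have h3 := hrow (i - 2)
    omega
  have hconj0 : ∀ k, i ≤ k → conjP nu k = 0 := by
    intro k hk
    have h1 := lt_conjP_iff hnu 0 k
    omega
  have hgc : i ≤ conjP nu (c - 1) := by
    have h1 := lt_conjP_iff hnu (i - 1) (c - 1)
    omega
  have hanti : ∀ j, conjP nu (j + 1) ≤ conjP nu j :=
    fun j => conjP_antitone hnu (Nat.le_add_right j 1)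
  have hS := corner_shape hnu h0 hrow hc hc1 hci hm
  have hG : ∀ j, cornerGamma nu i c j = if j < c then conjP nu j else if j < i then c - 1 else 0 :=
    fun _ => rfl
  refine nonempty_LRTableau (cornerLam_isPartition hnu hrow hc hci)
    (fun R C => if m ≤ C then R + 1 else R + i + c - m)
    (fun p => if m ≤ p.2 then (p.1 - 1, p.2)
      else if p.1 + i = m + 1 then (c - 1, 2 * m - 2 - p.2) else (p.1 - 1, p.2))
    ?_ ?_ ?_ ?_ ?_ ?_
  · intro R C h
    rw [hS] at h
    split_ifs <;> omega
  · intro R C C' hCC h h'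
    rw [hS] at h h'
    split_ifs <;> omega
  · intro R R' C hRR h h'
    rw [hS] at h h'
    split_ifs <;> omega
  · intro k
    simp only [hS]
    by_cases hkc : k < c
    · refine card_subtype_eq_of_param (fun s => (k, m + s)) ?_ ?_ ?_
      · intro s hs
        refine ⟨Or.inl ⟨by omega, by simp, ?_⟩, by simp⟩
        rw [hG, if_pos hkc]
        simpa using hs
      · intro s _ t _ h
        simpa using h
      · rintro ⟨R, C⟩ ⟨h, he⟩
        have := hG R
        refine ⟨C - m, ?_, ?_⟩
        · dsimp only at h he
          split_ifs at he this <;> try omega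
          obtain rfl : R = k := by omega
          omega
        · dsimp only at h he ⊢
          split_ifs at he <;> simp only [Prod.mk.injEq] <;> omega
    · by_cases hki : k < i
      · rw [hconj k (by omega) hki]
        refine card_subtype_eq_of_param
          (fun s => if s < c - 1 then (k, m + s) else (k + 1 + m - i - c, m - 2 - s)) ?_ ?_ ?_
        · intro s hs
          have := hG k
          rw [if_neg hkc, if_pos hki] at this
          by_cases hsc : s < c - 1
          · simp only [if_pos hsc, this]
            exact ⟨Or.inl ⟨hki, by omega, by omega⟩, if_pos (by omega)⟩
          · simp only [if_neg hsc]
            refine ⟨Or.inr ⟨by omega, by omega, by omega, by omega⟩, ?_⟩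
            rw [if_neg (by omega)]
            omega
        · intro s hs t ht h
          split_ifs at h <;> simp only [Prod.mk.injEq] at h <;> omega
        · rintro ⟨R, C⟩ ⟨h, he⟩
          dsimp only at h he
          by_cases hC : m ≤ C
          · rw [if_pos hC] at he
            obtain rfl : R = k := by omega
            have := hG R
            rw [if_neg hkc, if_pos hki] at this
            refine ⟨C - m, by omega, ?_⟩
            rw [if_pos (by omega), Prod.mk.injEq]
            omega
          · rw [if_neg hC] at he
            refine ⟨m - 2 - C, by omega, ?_⟩
            rw [if_neg (by omega), Prod.mk.injEq]
            omega
      · rw [hconj0 k (by omega)]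
        refine card_subtype_eq_of_param (fun _ => (0, 0)) (by simp) (by simp) ?_
        rintro ⟨R, C⟩ ⟨h, he⟩
        dsimp only at h he
        split_ifs at he <;> omega
  · intro R C h he
    rw [hS] at h
    dsimp only at he ⊢
    by_cases hC : m ≤ C
    · have h1 := hG R
      have h2 := hG (R - 1)
      have h3 := hanti (R - 1)
      rw [if_pos hC] at he
      rw [show R - 1 + 1 = R by omega] at h3
      simp only [if_pos hC, hS]
      have h4 : cornerGamma nu i c R ≤ cornerGamma nu i c (R - 1) := by
        rw [h1, h2]
        by_cases hRc : R = c
        · rw [hRc]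
          split_ifs <;> omega
        · split_ifs <;> omega
      omega
    · rw [if_neg hC] at he
      by_cases hR : R + i = m + 1
      · simp only [if_neg hC, if_pos hR, hS]
        have h2 := hG (c - 1)
        rw [if_pos (by omega)] at h2
        rw [if_pos (by omega)]
        omega
      · simp only [if_neg hC, if_neg hR, hS]
        omega
  · intro R C R' C' h h' he hee hMM
    rw [hS] at h h'
    have h1 := hG R
    have h2 := hG R'
    dsimp only at he hee hMM
    rw [Prod.mk.injEq]
    by_cases hC : m ≤ C <;> by_cases hC' : m ≤ C' <;>
      simp only [hC, hC', if_true, if_false] at he hee hMM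
    · rw [Prod.mk.injEq] at hMM
      omega
    · by_cases hR : R' + i = m + 1
      · rw [if_pos hR, Prod.mk.injEq] at hMM
        rw [if_neg (by omega), if_pos (by omega)] at h1
        omega
      · rw [if_neg hR, Prod.mk.injEq] at hMM
        omega
    · by_cases hR : R + i = m + 1
      · rw [if_pos hR, Prod.mk.injEq] at hMM
        rw [if_neg (by omega), if_pos (by omega)] at h2
        omega
      · rw [if_neg hR, Prod.mk.injEq] at hMM
        omega
    · split_ifs at hMM <;> rw [Prod.mk.injEq] at hMM <;> omega

theorem corner_no_tableau (hnu : IsPartition nu) (h0 : nu 0 = i)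
    (hrow : ∀ a, a + 1 < i → nu a = i) (hc : nu (i - 1) = c) (hc1 : 1 ≤ c) (hci : c < i)
    (hm : i + conjP nu 0 ≤ m) {mu : ℕ → ℕ} (hmu : IsPartition mu)
    (hadd : mu (i - 1) = c + 1) (hother : ∀ a, a ≠ i - 1 → mu a = nu a)
    (T : LRTableau (cornerLam nu i c m) (complP m mu) (conjP mu)) : False := by
  have hlam : IsPartition (cornerLam nu i c m) := cornerLam_isPartition hnu hrow hc hci
  have hL : i - 1 < conjP nu 0 := (lt_conjP_iff hnu _ _).2 (by omega)
  have hmu0 : mu 0 = i := by rw [hother 0 (by omega), h0]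
  have htop : ∀ R C, R < i → m ≤ C → C < m + cornerGamma nu i c R →
      inShape (cornerLam nu i c m) (complP m mu) R C := by
    intro R C hR h1 h2
    have h3 := corner_row hnu h0 hc hc1 hm hR
    refine ⟨?_, by omega⟩
    rw [complP]
    split_ifs <;> omega
  have hcol : ∀ a, c ≤ a + 1 → a < i →
      inShape (cornerLam nu i c m) (complP m mu) (m - 1 - a) (m - 1 - c) := by
    intro a ha hai
    have hmua : c < mu a := by
      by_cases h : a = i - 1
      · rw [h]
        omega
      · rw [hother a h, hrow a (by omega)]
        omega
    have heta : cornerEta nu i c a = c := by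
      unfold cornerEta
      split_ifs
      · rfl
      · rw [← hc]
        congr 1
        omega
    constructor
    · rw [complP, if_pos (by omega), show m - 1 - (m - 1 - a) = a by omega]
      omega
    · rw [cornerLam, if_pos (by omega), show m - 1 - (m - 1 - a) = a by omega, heta]
      omega
  have hfirst : c + 1 ≤ T.entry (m - i) (m - 1 - c) := by
    have hs := hcol (i - 1) (by omega) (by omega)
    rw [show m - 1 - (i - 1) = m - i by omega] at hs
    have h1 := T.one_le _ _ hs
    by_contra! hlt
    obtain ⟨k, hk⟩ : ∃ k, T.entry (m - i) (m - 1 - c) = k + 1 := ⟨_, (Nat.sub_add_cancel h1).symm⟩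
    have hkc : k < c := by omega
    have hent : ∀ j C, j ≤ k → m ≤ C → C < m + cornerGamma nu i c k →
        inShape (cornerLam nu i c m) (complP m mu) j C ∧ j + 1 ≤ T.entry j C := by
      intro j C hj hC hCk
      induction j with
      | zero =>
        have hle : cornerGamma nu i c k ≤ cornerGamma nu i c 0 := by
          simp only [cornerGamma, if_pos hkc, if_pos (show 0 < c from hc1)]
          exact conjP_antitone hnu (Nat.zero_le _)
        have := htop 0 C (by omega) hC (by omega)
        exact ⟨this, T.one_le _ _ this⟩
      | succ j ih =>
        obtain ⟨h2, h3⟩ := ih (by omega)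
        have hle : cornerGamma nu i c k ≤ cornerGamma nu i c (j + 1) := by
          simp only [cornerGamma, if_pos hkc, if_pos (show j + 1 < c by omega)]
          exact conjP_antitone hnu hj
        have h4 := htop (j + 1) C (by omega) hC (by omega)
        have := T.col_strict j (j + 1) C (by omega) h2 h4
        exact ⟨h4, by omega⟩
    have hmuk : conjP mu k = cornerGamma nu i c k := by
      rw [cornerGamma, if_pos hkc]
      refine eq_of_forall_lt_iff fun a => ?_
      rw [lt_conjP_iff hmu, lt_conjP_iff hnu]
      by_cases h : a = i - 1
      · rw [h]
        omega
      · rw [hother a h]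
    have hcont := T.content k
    rw [hmuk] at hcont
    have := cells_finite hlam (complP m mu) fun p => T.entry p.1 p.2 = k + 1
    have hcard := Nat.card_le_card_of_injective
      (fun s : Fin (cornerGamma nu i c k + 1) =>
        (⟨if s.1 < cornerGamma nu i c k then (k, m + s.1) else (m - i, m - 1 - c), by
          split_ifs with hlt'
          · obtain ⟨h2, h3⟩ := hent k (m + s.1) le_rfl (by omega) (by omega)
            exact ⟨h2, le_antisymm (entry_le_row hlam T h2) h3⟩
          · exact ⟨hs, hk⟩⟩ :
          {p : ℕ × ℕ // inShape (cornerLam nu i c m) (complP m mu) p.1 p.2 ∧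
            T.entry p.1 p.2 = k + 1}))
      (by
        intro s t h
        have h := congrArg (·.1) h
        simp only at h
        ext
        split_ifs at h <;> simp only [Prod.mk.injEq] at h <;> omega)
    rw [hcont, Nat.card_fin] at hcard
    omega
  have hstep : ∀ t, t + c ≤ i → c + 1 + t ≤ T.entry (m - i + t) (m - 1 - c) := by
    intro t ht
    induction t with
    | zero => exact hfirst
    | succ t ih =>
      have h1 := hcol (i - 1 - t) (by omega) (by omega)
      have h2 := hcol (i - 1 - (t + 1)) (by omega) (by omega)
      rw [show m - 1 - (i - 1 - t) = m - i + t by omega] at h1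
      rw [show m - 1 - (i - 1 - (t + 1)) = m - i + (t + 1) by omega] at h2
      have := T.col_strict _ (m - i + (t + 1)) _ (by omega) h1 h2
      have := ih (by omega)
      omega
  have hlast := hstep (i - c) (by omega)
  have hs := hcol (c - 1) (by omega) (by omega)
  rw [show m - 1 - (c - 1) = m - i + (i - c) by omega] at hs
  have hcont := T.content (T.entry (m - i + (i - c)) (m - 1 - c) - 1)
  have hzero : conjP mu (T.entry (m - i + (i - c)) (m - 1 - c) - 1) = 0 := by
    have := lt_conjP_iff hmu 0 (T.entry (m - i + (i - c)) (m - 1 - c) - 1)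
    omega
  have := cells_finite hlam (complP m mu) fun p =>
    T.entry p.1 p.2 = T.entry (m - i + (i - c)) (m - 1 - c) - 1 + 1
  rw [hzero, Finite.card_eq_zero_iff] at hcont
  exact hcont.false ⟨(m - i + (i - c), m - 1 - c), hs, by simp only; omega⟩

end SquareAtCorner

section BoxBelowSquare

/-- `nu` with its first `i` rows removed, padded by boxes in the first column until it has
`i - 1 - q` more rows. -/
noncomputable def belowEta (nu : ℕ → ℕ) (i q : ℕ) : ℕ → ℕ :=
  fun a => max (nu (a + i)) (if a + i < conjP nu 0 + (i - 1 - q) then 1 else 0)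

/-- The conjugate of the part of `nu` below row `i`, with `i - 1 - q` more boxes in its first
row. -/
noncomputable def belowSigma (nu : ℕ → ℕ) (i q : ℕ) : ℕ → ℕ :=
  fun j => conjP nu j - i + if j = 0 then i - 1 - q else 0

/-- The complement of `belowEta` in `(m^m)`, with `belowSigma` appended below. -/
noncomputable def belowLam (nu : ℕ → ℕ) (i q m : ℕ) : ℕ → ℕ :=
  appendAfter m (complP m (belowEta nu i q)) (belowSigma nu i q)

/-- The entries of a Littlewood–Richardson tableau of outer shape `belowLam`. -/
noncomputable def belowEntry (nu : ℕ → ℕ) (i q m : ℕ) : ℕ → ℕ → ℕ :=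
  fun R C =>
    if R < m then conjP nu (m - 1 - C) - (m - 1 - R) +
      if m - 1 - C = q ∧ m - 1 - R + q + 2 ≤ i then 1 else 0
    else if R = m ∧ conjP nu 0 ≤ C + i then i else R - m + 1

/-- The cell matched with a given cell of `belowEntry`, whose entry is smaller by one. -/
noncomputable def belowMatch (nu : ℕ → ℕ) (i q m : ℕ) : ℕ × ℕ → ℕ × ℕ :=
  fun p =>
    if p.1 < m ∧ m - 1 - p.2 = q ∧ m - 1 - p.1 + q + 2 = i then
      (m - 1 - (conjP nu 0 - q - 1), m - 1 - 0)
    else if p.1 = m ∧ conjP nu 0 ≤ p.2 + i then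
      (m - 1 - 0, m - 1 - (q + 1 + (p.2 + i - conjP nu 0)))
    else (p.1 - 1, p.2)

variable {nu : ℕ → ℕ} {i q m : ℕ}

theorem belowSigma_antitone (hnu : IsPartition nu) (i q : ℕ) : Antitone (belowSigma nu i q) := by
  refine antitone_nat_of_succ_le fun j => ?_
  have := conjP_antitone hnu (Nat.le_add_right j 1)
  simp only [belowSigma, Nat.add_eq_zero_iff, one_ne_zero, and_false, if_false]
  omega

theorem belowEta_antitone (hnu : IsPartition nu) (i q : ℕ) : Antitone (belowEta nu i q) := by
  refine antitone_nat_of_succ_le fun a => ?_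
  have := hnu.1 (show a + i ≤ a + 1 + i by omega)
  unfold belowEta
  split_ifs <;> omega

theorem belowEta_le (hnu : IsPartition nu) (h0 : nu 0 = i) (hq1 : 1 ≤ q) (a : ℕ) :
    belowEta nu i q a ≤ nu a := by
  have h1 := hnu.1 (Nat.le_add_right a i)
  have h2 := lt_conjP_iff hnu a 0
  unfold belowEta
  split_ifs <;> omega

theorem belowLam_isPartition (hnu : IsPartition nu) (h0 : nu 0 = i) (hi : i < conjP nu 0)
    (hq1 : 1 ≤ q) (hm : i + conjP nu 0 ≤ m) : IsPartition (belowLam nu i q m) := by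
  have hsig := belowSigma_antitone hnu i q
  have heta := belowEta_antitone hnu i q
  refine ⟨antitone_nat_of_succ_le fun R => ?_, m + (i + 1), ?_⟩
  · simp only [belowLam, appendAfter, complP]
    by_cases h1 : R + 1 < m
    · have := heta (show m - 1 - (R + 1) ≤ m - 1 - R by omega)
      rw [if_pos h1, if_pos h1, if_pos (by omega), if_pos (by omega)]
      omega
    · rw [if_neg h1]
      by_cases h2 : R < m
      · have h3 := belowEta_le hnu h0 hq1 (m - 1 - R)
        have h4 : nu (m - 1 - R) ≤ i := h0 ▸ hnu.1 (Nat.zero_le _)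
        have h5 : belowSigma nu i q (R + 1 - m) ≤ conjP nu 0 := by
          refine (hsig (Nat.zero_le _)).trans ?_
          simp only [belowSigma, if_true]
          omega
        rw [if_pos h2, if_pos h2]
        omega
      · rw [if_neg h2]
        exact hsig (by omega)
  · have h1 := lt_conjP_iff hnu 0 (i + 1)
    simp only [belowLam, appendAfter, belowSigma]
    rw [if_neg (by omega), show m + (i + 1) - m = i + 1 by omega, if_neg (by omega)]
    omega

theorem subP_belowLam (hnu : IsPartition nu) (h0 : nu 0 = i) (hq1 : 1 ≤ q) :
    subP (complP m nu) (belowLam nu i q m) := by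
  intro R
  have := belowEta_le hnu h0 hq1 (m - 1 - R)
  simp only [belowLam, appendAfter, complP]
  split_ifs <;> omega

theorem inShape_belowLam_reflect (hnu : IsPartition nu) (h0 : nu 0 = i) (hq1 : 1 ≤ q)
    (hm : i + conjP nu 0 ≤ m) {a x : ℕ} (ha : a < m) (hx : x < m) :
    inShape (belowLam nu i q m) (complP m nu) (m - 1 - a) (m - 1 - x) ↔
      a < conjP nu x ∧ conjP nu x ≤ a + i ∧ (a + i < conjP nu 0 + (i - 1 - q) → 1 ≤ x) := by
  have h1 := lt_conjP_iff hnu a x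
  have h2 := lt_conjP_iff hnu (a + i) x
  have h3 := belowEta_le hnu h0 hq1 a
  have h4 : nu a ≤ i := h0 ▸ hnu.1 (Nat.zero_le _)
  have h5 : belowEta nu i q a = max (nu (a + i)) _ := rfl
  simp only [inShape, belowLam, appendAfter, complP]
  rw [if_pos (by omega), if_pos (by omega), if_pos (by omega),
    show m - 1 - (m - 1 - a) = a by omega]
  split_ifs at h5 <;> omega

theorem inShape_belowLam_add {j C : ℕ} :
    inShape (belowLam nu i q m) (complP m nu) (m + j) C ↔ C < belowSigma nu i q j := by
  simp only [inShape, belowLam, appendAfter, complP]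
  rw [if_neg (by omega), if_neg (by omega), show m + j - m = j by omega]
  omega

theorem inShape_belowLam_cases (hnu : IsPartition nu) (h0 : nu 0 = i)
    (hm : i + conjP nu 0 ≤ m) {R C : ℕ}
    (h : inShape (belowLam nu i q m) (complP m nu) R C) :
    (∃ a x, a < conjP nu 0 ∧ x < i ∧ R = m - 1 - a ∧ C = m - 1 - x) ∨ ∃ j, R = m + j := by
  by_cases hR : R < m
  · refine Or.inl ⟨m - 1 - R, m - 1 - C, ?_⟩
    have h1 := lt_conjP_iff hnu (m - 1 - R) 0
    have h2 : nu (m - 1 - R) ≤ i := h0 ▸ hnu.1 (Nat.zero_le _)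
    simp only [inShape, belowLam, appendAfter, complP] at h
    rw [if_pos hR, if_pos hR, if_pos hR] at h
    omega
  · exact Or.inr ⟨R - m, by omega⟩

theorem belowEntry_reflect {a x : ℕ} (ha : a < m) (hx : x < m) :
    belowEntry nu i q m (m - 1 - a) (m - 1 - x) =
      conjP nu x - a + if x = q ∧ a + q + 2 ≤ i then 1 else 0 := by
  rw [belowEntry, if_pos (by omega), show m - 1 - (m - 1 - a) = a by omega,
    show m - 1 - (m - 1 - x) = x by omega]

theorem belowEntry_add {j C : ℕ} : belowEntry nu i q m (m + j) C =
    if j = 0 ∧ conjP nu 0 ≤ C + i then i else j + 1 := by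
  simp only [belowEntry, Nat.add_eq_left, Nat.add_sub_cancel_left]
  rw [if_neg (by omega)]

theorem belowMatch_reflect {a x : ℕ} (ha : a < m) (hx : x < m) :
    belowMatch nu i q m (m - 1 - a, m - 1 - x) = if x = q ∧ a + q + 2 = i then
      (m - 1 - (conjP nu 0 - q - 1), m - 1 - 0) else (m - 1 - (a + 1), m - 1 - x) := by
  simp only [belowMatch]
  rw [show m - 1 - (m - 1 - a) = a by omega, show m - 1 - (m - 1 - x) = x by omega,
    show m - 1 - a - 1 = m - 1 - (a + 1) by omega]
  by_cases h : x = q ∧ a + q + 2 = i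
  · rw [if_pos h, if_pos ⟨by omega, h⟩]
  · rw [if_neg h, if_neg fun h' => h h'.2, if_neg (by omega)]

theorem belowMatch_add {j C : ℕ} : belowMatch nu i q m (m + j, C) =
    if j = 0 ∧ conjP nu 0 ≤ C + i then (m - 1 - 0, m - 1 - (q + 1 + (C + i - conjP nu 0)))
    else (m + j - 1, C) := by
  simp only [belowMatch, Nat.add_eq_left]
  rw [if_neg (by omega)]

theorem conjP_bounds (hnu : IsPartition nu) (h0 : nu 0 = i) (hrow : ∀ a, a + 1 < i → nu a = i)
    (hq : nu (i - 1) = q) (hq1 : 1 ≤ q) (x : ℕ) :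
    (x < q → i ≤ conjP nu x) ∧ (q ≤ x → x < i → conjP nu x + 1 = i) ∧
      (i ≤ x → conjP nu x = 0) ∧ conjP nu x ≤ conjP nu 0 := by
  have hqi : q ≤ i := by
    rw [← h0, ← hq]
    exact hnu.1 (Nat.zero_le _)
  have h1 := lt_conjP_iff hnu (i - 1) x
  have h2 := lt_conjP_iff hnu (i - 2) x
  have h3 := hrow (i - 2)
  have h4 := lt_conjP_iff hnu 0 x
  exact ⟨by omega, by omega, by omega, conjP_antitone hnu (Nat.zero_le _)⟩

theorem card_belowEntry_lt (hnu : IsPartition nu) (h0 : nu 0 = i)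
    (hrow : ∀ a, a + 1 < i → nu a = i) (hi : i < conjP nu 0)
    (hq : nu (i - 1) = q) (hq1 : 1 ≤ q) (hm : i + conjP nu 0 ≤ m) {k : ℕ} (hk : k < q) :
    Nat.card {p : ℕ × ℕ // inShape (belowLam nu i q m) (complP m nu) p.1 p.2 ∧
      belowEntry nu i q m p.1 p.2 = k + 1} = conjP nu k := by
  have hqi : q ≤ i := by
    rw [← h0, ← hq]
    exact hnu.1 (Nat.zero_le _)
  have hb := conjP_bounds hnu h0 hrow hq hq1
  have hbk := hb k
  refine card_subtype_eq_of_param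
    (fun s => if s < i then (m - 1 - (conjP nu s - (k + 1)), m - 1 - s) else (m + k, s - i))
    ?_ ?_ ?_
  · intro s hs
    have hbs := hb s
    by_cases hsi : s < i
    · simp only [if_pos hsi]
      rw [inShape_belowLam_reflect hnu h0 hq1 hm (by omega) (by omega),
        belowEntry_reflect (by omega) (by omega), if_neg (by omega)]
      refine ⟨⟨by omega, by omega, fun h => ?_⟩, by omega⟩
      by_contra hs0
      obtain rfl : s = 0 := by omega
      omega
    · simp only [if_neg hsi]
      rw [inShape_belowLam_add, belowEntry_add, belowSigma]
      by_cases hk0 : k = 0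
      · subst hk0
        rw [if_pos rfl, if_neg (by omega)]
        omega
      · rw [if_neg (by omega), if_neg (by omega)]
        omega
  · intro s hs t ht h
    split_ifs at h <;> simp only [Prod.mk.injEq] at h <;> omega
  · rintro ⟨R, C⟩ ⟨h, he⟩
    obtain ⟨a, x, ha, hx, rfl, rfl⟩ | ⟨j, rfl⟩ := inShape_belowLam_cases hnu h0 hm h
    · have hbx := hb x
      simp only at h he
      rw [inShape_belowLam_reflect hnu h0 hq1 hm (by omega) (by omega)] at h
      rw [belowEntry_reflect (by omega) (by omega)] at he
      refine ⟨x, by omega, ?_⟩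
      rw [if_pos hx]
      have : conjP nu x - (k + 1) = a := by split_ifs at he <;> omega
      rw [this]
    · simp only at h he
      rw [inShape_belowLam_add, belowSigma] at h
      rw [belowEntry_add] at he
      by_cases hj : j = 0
      · subst hj
        rw [if_pos rfl] at h
        obtain rfl : k = 0 := by split_ifs at he <;> omega
        refine ⟨C + i, ?_, ?_⟩
        · split_ifs at he <;> omega
        · rw [if_neg (by omega), Nat.add_sub_cancel]
      · rw [if_neg hj] at h
        rw [if_neg (by omega)] at he
        obtain rfl : k = j := by omega
        refine ⟨C + i, by omega, ?_⟩
        rw [if_neg (by omega), Nat.add_sub_cancel]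

theorem card_belowEntry_ge (hnu : IsPartition nu) (h0 : nu 0 = i)
    (hrow : ∀ a, a + 1 < i → nu a = i) (hi : i < conjP nu 0)
    (hq : nu (i - 1) = q) (hq1 : 1 ≤ q) (hm : i + conjP nu 0 ≤ m) {k : ℕ} (hk : q ≤ k)
    (hki : k < i) :
    Nat.card {p : ℕ × ℕ // inShape (belowLam nu i q m) (complP m nu) p.1 p.2 ∧
      belowEntry nu i q m p.1 p.2 = k + 1} = i - 1 := by
  have hb := conjP_bounds hnu h0 hrow hq hq1
  have hbk := hb k
  set xs : ℕ → ℕ := fun s => if k = q ∧ s < q then s else s + 1 with hxs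
  refine card_subtype_eq_of_param
    (fun s => if k ≠ q ∧ k + 1 = i ∧ q ≤ s then (m + 0, conjP nu 0 - i + (s - q))
      else (m - 1 - (conjP nu (xs s) + (if xs s = q then 1 else 0) - (k + 1)), m - 1 - xs s))
    ?_ ?_ ?_
  · intro s hs
    have hbs := hb (xs s)
    have hx : xs s = if k = q ∧ s < q then s else s + 1 := rfl
    by_cases hsp : k ≠ q ∧ k + 1 = i ∧ q ≤ s
    · simp only [if_pos hsp]
      rw [inShape_belowLam_add, belowEntry_add, belowSigma, if_pos rfl, if_pos (by omega)]
      omega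
    · simp only [if_neg hsp]
      generalize xs s = x at *
      have hxi : x < i := by split_ifs at hx <;> omega
      by_cases hxq : x = q
      · have hkq : k ≠ q := by split_ifs at hx <;> omega
        rw [if_pos hxq, inShape_belowLam_reflect hnu h0 hq1 hm (by omega) (by omega),
          belowEntry_reflect (by omega) (by omega), if_pos (by omega)]
        omega
      · rw [if_neg hxq, inShape_belowLam_reflect hnu h0 hq1 hm (by omega) (by omega),
          belowEntry_reflect (by omega) (by omega), if_neg (by omega)]
        have hkx : k + 1 ≤ conjP nu x := by split_ifs at hx <;> omega
        refine ⟨⟨by omega, by omega, fun h => ?_⟩, by omega⟩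
        by_contra hx0
        obtain rfl : x = 0 := by omega
        split_ifs at hx
        omega
  · intro s hs t ht h
    have hx : ∀ u, xs u = if k = q ∧ u < q then u else u + 1 := fun _ => rfl
    have hxi : ∀ u < i - 1, ¬ (k ≠ q ∧ k + 1 = i ∧ q ≤ u) → xs u < i := by
      intro u hu _
      have := hx u
      split_ifs at this <;> omega
    clear_value xs
    by_cases hsp : k ≠ q ∧ k + 1 = i ∧ q ≤ s <;> by_cases htp : k ≠ q ∧ k + 1 = i ∧ q ≤ t
    · simp only [if_pos hsp, if_pos htp, Prod.mk.injEq] at h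
      omega
    · simp only [if_pos hsp, if_neg htp, Prod.mk.injEq] at h
      omega
    · simp only [if_neg hsp, if_pos htp, Prod.mk.injEq] at h
      omega
    · simp only [if_neg hsp, if_neg htp, Prod.mk.injEq] at h
      have h1 := hxi s hs hsp
      have h2 := hxi t ht htp
      have h3 : xs s = xs t := by omega
      rw [hx, hx] at h3
      split_ifs at h3 <;> omega
  · rintro ⟨R, C⟩ ⟨h, he⟩
    obtain ⟨a, x, ha, hx, rfl, rfl⟩ | ⟨j, rfl⟩ := inShape_belowLam_cases hnu h0 hm h
    · have hbx := hb x
      simp only at h he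
      rw [inShape_belowLam_reflect hnu h0 hq1 hm (by omega) (by omega)] at h
      rw [belowEntry_reflect (by omega) (by omega)] at he
      have hxq : k = q → x ≠ q := by split_ifs at he <;> omega
      have hx0 : k ≠ q → x ≠ 0 := by
        rintro hkq rfl
        split_ifs at he <;> omega
      obtain ⟨s, hs⟩ : ∃ s, s = if k = q ∧ x < q then x else x - 1 := ⟨_, rfl⟩
      have hsx : xs s = x := by
        simp only [hxs]
        split_ifs at hs ⊢ <;> omega
      refine ⟨s, by split_ifs at hs <;> omega, ?_⟩
      rw [if_neg (by split_ifs at hs he <;> omega), hsx]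
      have : conjP nu x + (if x = q then 1 else 0) - (k + 1) = a := by
        split_ifs at he ⊢ <;> omega
      rw [this]
    · simp only at h he
      rw [inShape_belowLam_add, belowSigma] at h
      rw [belowEntry_add] at he
      by_cases hj : j = 0 ∧ conjP nu 0 ≤ C + i
      · rw [if_pos hj] at he
        rw [if_pos hj.1, hj.1] at h
        refine ⟨C + i - conjP nu 0 + q, by omega, ?_⟩
        rw [if_pos (by omega), Prod.mk.injEq]
        omega
      · rw [if_neg hj] at he
        obtain rfl : k = j := by omega
        rw [if_neg (by omega)] at h
        omega

theorem below_tableau (hnu : IsPartition nu) (h0 : nu 0 = i)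
    (hrow : ∀ a, a + 1 < i → nu a = i) (hi : i < conjP nu 0)
    (hq : nu (i - 1) = q) (hq1 : 1 ≤ q) (hm : i + conjP nu 0 ≤ m) :
    Nonempty (LRTableau (belowLam nu i q m) (complP m nu) (conjP nu)) := by
  have hqi : q ≤ i := by
    rw [← h0, ← hq]
    exact hnu.1 (Nat.zero_le _)
  have hb := conjP_bounds hnu h0 hrow hq hq1
  have hcases := fun {R C} => inShape_belowLam_cases (q := q) (R := R) (C := C) hnu h0 hm
  have hS := fun {a x} => inShape_belowLam_reflect (a := a) (x := x) hnu h0 hq1 hm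
  have hsig0 : belowSigma nu i q 0 = conjP nu 0 - i + (i - 1 - q) := rfl
  have hsig : ∀ j, j ≠ 0 → belowSigma nu i q j = conjP nu j - i := by
    intro j hj
    rw [belowSigma, if_neg hj, Nat.add_zero]
  refine nonempty_LRTableau (belowLam_isPartition hnu h0 hi hq1 hm) (belowEntry nu i q m)
    (belowMatch nu i q m) ?_ ?_ ?_ ?_ ?_ ?_
  · intro R C h
    obtain ⟨a, x, ha, hx, rfl, rfl⟩ | ⟨j, rfl⟩ := hcases h
    · rw [hS (by omega) (by omega)] at h
      rw [belowEntry_reflect (by omega) (by omega)]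
      omega
    · rw [belowEntry_add]
      split_ifs <;> omega
  · intro R C C' hCC h h'
    obtain ⟨a, x, ha, hx, rfl, rfl⟩ | ⟨j, rfl⟩ := hcases h
    · obtain ⟨a', x', ha', hx', h1, rfl⟩ | ⟨j, h1⟩ := hcases h'
      · have hbx := hb x
        have hbx' := hb x'
        have hanti := conjP_antitone hnu (show x' ≤ x by omega)
        rw [hS (by omega) (by omega)] at h h'
        rw [belowEntry_reflect (by omega) (by omega), belowEntry_reflect (by omega) (by omega)]
        split_ifs <;> omega
      · omega
    · rw [belowEntry_add, belowEntry_add]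
      split_ifs <;> omega
  · intro R R' C hRR h h'
    obtain ⟨a, x, ha, hx, rfl, rfl⟩ | ⟨j, rfl⟩ := hcases h <;>
    obtain ⟨a', x', ha', hx', rfl, hC⟩ | ⟨j', rfl⟩ := hcases h'
    · obtain rfl : x = x' := by omega
      rw [hS (by omega) (by omega)] at h h'
      rw [belowEntry_reflect (by omega) (by omega), belowEntry_reflect (by omega) (by omega)]
      split_ifs <;> omega
    · rw [inShape_belowLam_add] at h'
      have := belowSigma_antitone hnu i q (Nat.zero_le j')
      omega
    · omega
    · rw [inShape_belowLam_add, hsig j' (by omega)] at h'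
      have := hb j'
      rw [belowEntry_add, belowEntry_add]
      split_ifs <;> omega
  · intro k
    by_cases hkq : k < q
    · exact card_belowEntry_lt hnu h0 hrow hi hq hq1 hm hkq
    · have hbk := hb k
      by_cases hki : k < i
      · rw [card_belowEntry_ge hnu h0 hrow hi hq hq1 hm (not_lt.1 hkq) hki]
        omega
      · rw [(hb k).2.2.1 (not_lt.1 hki)]
        refine card_subtype_eq_of_param (fun _ => (0, 0)) (by simp) (by simp) ?_
        rintro ⟨R, C⟩ ⟨h, he⟩
        exfalso
        simp only at h he
        obtain ⟨a, x, ha, hx, rfl, rfl⟩ | ⟨j, rfl⟩ := hcases h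
        · have hbx := hb x
          rw [hS (by omega) (by omega)] at h
          rw [belowEntry_reflect (by omega) (by omega)] at he
          split_ifs at he <;> omega
        · have hbj := hb j
          rw [inShape_belowLam_add] at h
          have hsj := hsig j
          rw [belowEntry_add] at he
          split_ifs at he <;> omega
  · intro R C h he
    obtain ⟨a, x, ha, hx, rfl, rfl⟩ | ⟨j, rfl⟩ := hcases h
    · have hbx := hb x
      rw [hS (by omega) (by omega)] at h
      rw [belowEntry_reflect (by omega) (by omega)] at he ⊢
      rw [belowMatch_reflect (by omega) (by omega)]
      by_cases hsp : x = q ∧ a + q + 2 = i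
      · rw [if_pos hsp, if_pos (by omega)]
        rw [hS (by omega) (by omega), belowEntry_reflect (by omega) (by omega), if_neg (by omega)]
        omega
      · rw [if_neg hsp]
        rw [hS (by omega) (by omega), belowEntry_reflect (by omega) (by omega)]
        split_ifs at he ⊢ <;> omega
    · rw [inShape_belowLam_add] at h
      rw [belowEntry_add] at he ⊢
      rw [belowMatch_add]
      by_cases hsp : j = 0 ∧ conjP nu 0 ≤ C + i
      · obtain ⟨rfl, hC⟩ := hsp
        rw [if_pos ⟨rfl, hC⟩, if_pos ⟨rfl, hC⟩]
        have hbx := hb (q + 1 + (C + i - conjP nu 0))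
        rw [hS (by omega) (by omega), belowEntry_reflect (by omega) (by omega), if_neg (by omega)]
        omega
      · rw [if_neg hsp] at he ⊢
        obtain ⟨j, rfl⟩ : ∃ j', j = j' + 1 := ⟨j - 1, by omega⟩
        rw [if_neg hsp, show m + (j + 1) - 1 = m + j by omega]
        have h1 := belowSigma_antitone hnu i q (Nat.le_add_right j 1)
        have h2 := hsig (j + 1) (by omega)
        have h3 := hb (j + 1)
        rw [inShape_belowLam_add, belowEntry_add, if_neg (by omega)]
        omega
  · intro R C R' C' h h' he hee hMM
    obtain ⟨a, x, ha, hx, rfl, rfl⟩ | ⟨j, rfl⟩ := hcases h <;>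
    obtain ⟨a', x', ha', hx', rfl, rfl⟩ | ⟨j', rfl⟩ := hcases h'
    · rw [hS (by omega) (by omega)] at h h'
      rw [belowMatch_reflect (by omega) (by omega), belowMatch_reflect (by omega) (by omega)] at hMM
      have hkey : a = a' ∧ x = x' := by
        split_ifs at hMM
        · omega
        · rw [Prod.mk.injEq] at hMM
          obtain rfl : x' = 0 := by omega
          omega
        · rw [Prod.mk.injEq] at hMM
          obtain rfl : x = 0 := by omega
          omega
        · rw [Prod.mk.injEq] at hMM
          omega
      rw [hkey.1, hkey.2]
    · rw [belowMatch_reflect (by omega) (by omega), belowMatch_add] at hMM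
      rw [belowEntry_add] at hee
      split_ifs at hMM hee <;> rw [Prod.mk.injEq] at hMM <;> omega
    · rw [belowMatch_reflect (by omega) (by omega), belowMatch_add] at hMM
      rw [belowEntry_add] at he hee
      split_ifs at hMM hee he <;> rw [Prod.mk.injEq] at hMM <;> omega
    · rw [inShape_belowLam_add] at h h'
      rw [belowEntry_add] at he hee
      rw [belowEntry_add] at hee
      have hj : j = 0 → belowSigma nu i q j = belowSigma nu i q 0 := fun h => by rw [h]
      have hj' : j' = 0 → belowSigma nu i q j' = belowSigma nu i q 0 := fun h => by rw [h]
      rw [belowMatch_add, belowMatch_add] at hMM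
      rw [Prod.mk.injEq]
      split_ifs at hMM hee he <;> rw [Prod.mk.injEq] at hMM <;> omega

/-- The number of entries equal to `k + 1` in rows `≥ a`. -/
noncomputable def lowerCount {lam alpha beta : ℕ → ℕ} (T : LRTableau lam alpha beta) (k a : ℕ) :
    ℕ :=
  Nat.card {p : ℕ × ℕ // inShape lam alpha p.1 p.2 ∧ a ≤ p.1 ∧ T.entry p.1 p.2 = k + 1}

theorem le_rowsCount_add_lowerCount {lam alpha beta : ℕ → ℕ} (hlam : IsPartition lam)
    (T : LRTableau lam alpha beta) (k a : ℕ) : beta k ≤ rowsCount T k a + lowerCount T k a := by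
  classical
  have := cells_finite hlam alpha fun p => p.1 < a ∧ T.entry p.1 p.2 = k + 1
  have := cells_finite hlam alpha fun p => a ≤ p.1 ∧ T.entry p.1 p.2 = k + 1
  rw [← T.content k, rowsCount, lowerCount, ← Nat.card_sum]
  refine Nat.card_le_card_of_injective
    (fun p => if h : p.1.1 < a then Sum.inl ⟨p.1, p.2.1, h, p.2.2⟩
      else Sum.inr ⟨p.1, p.2.1, not_lt.1 h, p.2.2⟩) ?_
  intro p p' h
  simp only at h
  split_ifs at h <;> simp only [Sum.inl.injEq, Sum.inr.injEq, Subtype.mk.injEq] at h <;>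
    exact Subtype.ext h

theorem rowsCount_le_of_columns {lam alpha beta : ℕ → ℕ}
    (T : LRTableau lam alpha beta) {k a l n : ℕ}
    (h : ∀ R C, inShape lam alpha R C → R < a → l ≤ C ∧ C < l + n) : rowsCount T k a ≤ n := by
  rw [rowsCount, ← Nat.card_fin n]
  refine Nat.card_le_card_of_injective
    (fun p => (⟨p.1.2 - l, by have := h _ _ p.2.1 p.2.2.1; omega⟩ : Fin n)) ?_
  rintro ⟨⟨R, C⟩, hs, hR, he⟩ ⟨⟨R', C'⟩, hs', hR', he'⟩ heq
  have h1 := h R C hs hR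
  have h2 := h R' C' hs' hR'
  simp only [Fin.mk.injEq] at heq he he'
  obtain rfl : C = C' := by omega
  rcases lt_trichotomy R R' with hlt | rfl | hlt
  · have := T.col_strict R R' C hlt hs hs'
    omega
  · rfl
  · have := T.col_strict R' R C hlt hs' hs
    omega

theorem sum_lowerCount_le (hnu : IsPartition nu) (h0 : nu 0 = i) (hi1 : 1 ≤ i)
    (hlam : IsPartition (belowLam nu i q m)) {alpha beta : ℕ → ℕ}
    (T : LRTableau (belowLam nu i q m) alpha beta) :
    ∑ k ∈ Finset.range i, lowerCount T k m ≤ ∑ j ∈ Finset.range i, belowSigma nu i q j := by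
  have hcell : ∀ p : ℕ × ℕ, inShape (belowLam nu i q m) alpha p.1 p.2 → m ≤ p.1 →
      p.1 - m < i ∧ p.2 < belowSigma nu i q (p.1 - m) := by
    intro p hs hp
    have h1 : p.2 < belowSigma nu i q (p.1 - m) := by
      have := hs.2
      rwa [belowLam, appendAfter, if_neg (by omega)] at this
    refine ⟨?_, h1⟩
    by_contra hlt
    have := lt_conjP_iff hnu 0 (p.1 - m)
    rw [belowSigma, if_neg (by omega)] at h1
    omega
  have hfin : ∀ k : Fin i, Finite {p : ℕ × ℕ // inShape (belowLam nu i q m) alpha p.1 p.2 ∧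
      m ≤ p.1 ∧ T.entry p.1 p.2 = k + 1} := fun k => cells_finite hlam alpha _
  have hcard : ∑ j ∈ Finset.range i, belowSigma nu i q j =
      Nat.card ↥((Finset.range i).sigma fun j => Finset.range (belowSigma nu i q j)) := by
    rw [Nat.card_eq_fintype_card, Fintype.card_coe, Finset.card_sigma]
    simp
  rw [hcard, Finset.sum_range]
  simp only [lowerCount]
  rw [← Nat.card_sigma]
  refine Nat.card_le_card_of_injective (fun p => ⟨⟨p.2.1.1 - m, p.2.1.2⟩, ?_⟩) ?_
  · have := hcell p.2.1 p.2.2.1 p.2.2.2.1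
    simpa using this
  · rintro ⟨k, ⟨R, C⟩, hs, hR, he⟩ ⟨k', ⟨R', C'⟩, hs', hR', he'⟩ h
    simp only [Subtype.mk.injEq, Sigma.mk.injEq, heq_eq_eq] at h
    simp only at hR hR' he he'
    obtain rfl : R = R' := by omega
    obtain rfl : C = C' := h.2
    obtain rfl : k = k' := Fin.ext (by omega)
    rfl

theorem below_no_tableau (hnu : IsPartition nu) (h0 : nu 0 = i)
    (hrow : ∀ a, a + 1 < i → nu a = i) (hi : i < conjP nu 0)
    (hq : nu (i - 1) = q) (hq1 : 1 ≤ q) (hm : i + conjP nu 0 ≤ m) {mu : ℕ → ℕ}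
    (hmu : IsPartition mu) {r : ℕ} (hr : i ≤ r) (hadd : mu r = nu r + 1)
    (hother : ∀ a, a ≠ r → mu a = nu a)
    (T : LRTableau (belowLam nu i q m) (complP m mu) (conjP mu)) : False := by
  have hlam := belowLam_isPartition hnu h0 hi hq1 hm
  have hqi : q ≤ i := by
    rw [← h0, ← hq]
    exact hnu.1 (Nat.zero_le _)
  have hmuq : mu (i - 1) = q := by rw [hother _ (by omega), hq]
  have hmur : mu r ≤ q := hmuq ▸ hmu.1 (by omega)
  have hmu0 : mu 0 = i := by rw [hother 0 (by omega), h0]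
  have hlower : ∀ k ∈ Finset.range i, (conjP nu k - i) + (if k = i - 1 then i - 1 - q else 0) +
      (if k = nu r then 1 else 0) ≤ lowerCount T k m := by
    intro k hk
    rw [Finset.mem_range] at hk
    have hmuk : mu k ≤ i := hmu0 ▸ hmu.1 (Nat.zero_le _)
    have h1 := le_rowsCount_add_lowerCount hlam T k m
    have h2 := rowsCount_add_le hlam T 0 (m - k) k
    rw [Nat.zero_add, show m - k + k = m by omega] at h2
    have h3 : rowsCount T 0 (m - k) ≤ mu k := by
      refine rowsCount_le_of_columns T (l := m - mu k) fun R C hs hR => ?_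
      simp only [inShape, belowLam, appendAfter, complP] at hs
      rw [if_pos (by omega), if_pos (by omega), if_pos (by omega)] at hs
      have := hmu.1 (show k ≤ m - 1 - R by omega)
      omega
    have h4 : conjP nu k + (if k = nu r then 1 else 0) ≤ conjP mu k := by
      have h5 := lt_conjP_iff hnu r k
      have h6 := lt_conjP_iff hmu r k
      have h7 : conjP nu k ≤ conjP mu k := by
        refine le_of_forall_lt fun a ha => ?_
        rw [lt_conjP_iff hnu] at ha
        rw [lt_conjP_iff hmu]
        by_cases har : a = r
        · rw [har] at ha ⊢
          omega
        · rwa [hother a har]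
      split_ifs <;> omega
    have h8 := lt_conjP_iff hnu r k
    have h9 := lt_conjP_iff hmu r k
    have h10 := (conjP_bounds hnu h0 hrow hq hq1 k).2.1
    have h11 := hrow k
    have h12 := hother k (by omega)
    by_cases hki : k = i - 1
    · rw [if_pos hki]
      rw [← hki] at hmuq
      split_ifs at h4 ⊢ <;> omega
    · rw [if_neg hki]
      split_ifs at h4 ⊢ <;> omega
  have hsum := (Finset.sum_le_sum hlower).trans (sum_lowerCount_le hnu h0 (by omega) hlam T)
  simp only [belowSigma, Finset.sum_add_distrib, Finset.sum_ite_eq', Finset.mem_range] at hsum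
  rw [if_pos (by omega), if_pos (by omega), if_pos (by omega)] at hsum
  omega

end BoxBelowSquare

/-- a nonempty type-1 partition `ν` containing the rectangle
`(ν₁^{ν₁ - 1})` is not covered by any partition `μ ⊇ ν` with `|μ| = |ν| + 1` other than
`ν + (1)`. -/
theorem type1_large_rectangle_unique_cover (nu mu : ℕ → ℕ)
    (h1 : Type1 nu) (hne : nu 0 ≠ 0)
    (hrect : subP (fun j => if j < nu 0 - 1 then nu 0 else 0) nu)
    (hmu : IsPartition mu) (hsub : subP nu mu) (hsz : psize mu = psize nu + 1)
    (hne' : mu ≠ addRow1 nu) :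
    ¬ Covers mu nu := by
  intro hcov
  have hnu := h1.1
  obtain ⟨i, h0⟩ : ∃ i, nu 0 = i := ⟨_, rfl⟩
  obtain ⟨q, hq⟩ : ∃ q, nu (i - 1) = q := ⟨_, rfl⟩
  have hle : ∀ a, nu a ≤ i := fun a => h0 ▸ hnu.1 (Nat.zero_le a)
  have hrow : ∀ a, a + 1 < i → nu a = i := by
    intro a ha
    have := hrect a
    simp only [h0] at this
    rw [if_pos (by omega)] at this
    exact le_antisymm (hle a) this
  have hbeta := h1.2
  rw [h0] at hbeta hne
  have hi : i < conjP nu 0 := by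
    rw [lt_conjP_iff hnu]
    have := hbeta i
    unfold betaShape at this
    split_ifs at this <;> omega
  have hq1 : 1 ≤ q := by
    have := (lt_conjP_iff hnu (i - 1) 0).1 (by omega)
    omega
  obtain ⟨r, hadd, hother⟩ := exists_added_row hnu hmu hsub hsz
  have hr0 : r ≠ 0 := by
    rintro rfl
    refine hne' (funext fun j => ?_)
    rw [addRow1]
    split_ifs with hj
    · rw [hj, hadd]
    · exact hother j hj
  have hmu0 : mu 0 = i := by rw [hother 0 hr0.symm, h0]
  have hmur : mu r ≤ i := hmu0 ▸ hmu.1 (Nat.zero_le r)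
  have hri : i - 1 ≤ r := by
    by_contra! hlt
    have := hrow r (by omega)
    omega
  have hm : i + conjP nu 0 ≤ mu 0 + plen mu := by
    have h2 := lt_conjP_iff hnu (plen mu) 0
    have h3 := hsub (plen mu)
    have h4 := apply_plen hmu
    omega
  have key : ∀ lam, IsPartition lam → subP (complP (mu 0 + plen mu) nu) lam →
      Nonempty (LRTableau lam (complP (mu 0 + plen mu) nu) (conjP nu)) →
      (LRTableau lam (complP (mu 0 + plen mu) mu) (conjP mu) → False) → False := by
    intro lam hlam hs hT hno
    have h2 := hcov _ le_rfl lam hlam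
    rw [LRcoeff_eq_zero hno] at h2
    exact absurd (LRcoeff_pos hlam hs hT) (by omega)
  by_cases hrc : r = i - 1
  · subst hrc
    have hqi : q < i := by omega
    exact key _ (cornerLam_isPartition hnu hrow hq hqi) (subP_cornerLam hrow hqi)
      (corner_tableau hnu h0 hrow hq hq1 hqi hm)
      (corner_no_tableau hnu h0 hrow hq hq1 hqi hm hmu (hq ▸ hadd) hother)
  · exact key _ (belowLam_isPartition hnu h0 hi hq1 hm) (subP_belowLam hnu h0 hq1)
      (below_tableau hnu h0 hrow hi hq hq1 hm)
      (below_no_tableau hnu h0 hrow hi hq hq1 hm hmu (by omega) hadd hother)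
end
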